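/- arXiv:1509.06331 — 3 statements merged into one kernel-verified Lean document; each statement's English description precedes it below -/
import Mathlib

section
/- Let β ∈ Φ⁺ be a reduced positive root of osp(1|2n) and m a positive integer. Then the m-fold concatenation ι⁺(β)^m is the lexicographically smallest dominant word of weight mβ. -/
namespace SpinQHA

/-- The coefficient field `ℚ(q)`. -/
abbrev Kq : Type := RatFunc ℚ

/-- The variable `q`. -/
noncomputable def qX : Kq := RatFunc.X

/-- Parity of the letter `i`.  The alphabet is `Fin (n+2)` (so the rank is `n+2 ≥ 2`);
the index `i` represents the letter `i+1`, and the last letter is the unique odd one. -/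
def pa (n : ℕ) (i : Fin (n+2)) : ℕ := if (i : ℕ) = n+1 then 1 else 0

/-- Symmetrized Cartan matrix of `osp(1|2(n+2))`. -/
def cart (n : ℕ) (i j : Fin (n+2)) : ℤ :=
  if i = j then (if (i : ℕ) = n+1 then 2 else 4)
  else if (i : ℕ) + 1 = (j : ℕ) ∨ (j : ℕ) + 1 = (i : ℕ) then -2 else 0

/-- Bilinear form on `Q⁺` (elements recorded by their coordinates). -/
def bil (n : ℕ) (μ ν : Fin (n+2) → ℕ) : ℤ :=
  ∑ i, ∑ j, (μ i : ℤ) * (ν j : ℤ) * cart n i j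

/-- Weight `|w| ∈ Q⁺` of a word. -/
def wt (n : ℕ) (w : List (Fin (n+2))) : Fin (n+2) → ℕ := fun i => w.count i

/-- Parity (as a natural number, read mod 2) of a word. -/
def pw (n : ℕ) (w : List (Fin (n+2))) : ℕ := (w.map (pa n)).sum

/-- `F`, the free `ℚ(q)`-module on the set of words. -/
abbrev F (n : ℕ) : Type := List (Fin (n+2)) →₀ Kq

/-- Quantum shuffle of two words, computed in the "reversed" representation where the
head of each list is the *last* letter of the corresponding word; this encodes the
inductive rule `(xi) ⋄ (yj) = (x ⋄ (yj))i + (-1)^{p(xi)p(j)} q^{-(|xi|,|j|)} ((xi) ⋄ y)j`. -/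
noncomputable def shAux (n : ℕ) : List (Fin (n+2)) → List (Fin (n+2)) → F n
  | [], y => Finsupp.single y 1
  | x, [] => Finsupp.single x 1
  | i :: x, j :: y =>
      Finsupp.mapDomain (List.cons i) (shAux n x (j :: y))
      + ((-1 : Kq) ^ (pw n (i :: x) * pa n j)
          * qX ^ (-(bil n (wt n (i :: x)) (wt n [j])))) •
          Finsupp.mapDomain (List.cons j) (shAux n (i :: x) y)
  termination_by x y => x.length + y.length

/-- Quantum shuffle product of two words. -/
noncomputable def shw (n : ℕ) (x y : List (Fin (n+2))) : F n :=
  Finsupp.mapDomain List.reverse (shAux n x.reverse y.reverse)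

/-- The quantum shuffle product `⋄` on `F`, extended bilinearly. -/
noncomputable def diam (n : ℕ) (u v : F n) : F n :=
  u.sum fun x cx => v.sum fun y cy => (cx * cy) • shw n x y

/-- Strict lexicographic order `≺` on words. -/
def wlt (n : ℕ) (v w : List (Fin (n+2))) : Prop := List.Lex (· < ·) v w

/-- A word is Lyndon if it is nonempty and lexicographically smaller than each of its
proper nonempty suffixes. -/
def IsLyndonW (n : ℕ) (w : List (Fin (n+2))) : Prop :=
  w ≠ [] ∧ ∀ s t : List (Fin (n+2)), w = s ++ t → s ≠ [] → t ≠ [] → wlt n w t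

/-- Iterated shuffle products of one-letter words. -/
noncomputable def prodLetters (n : ℕ) : List (Fin (n+2)) → F n
  | [] => Finsupp.single [] 1
  | i :: l => diam n (Finsupp.single [i] 1) (prodLetters n l)

/-- `U`, the subalgebra of `(F,⋄)` generated by the one-letter words, realized as the
`ℚ(q)`-span of all iterated shuffle products of letters. -/
noncomputable def Ualg (n : ℕ) : Submodule Kq (F n) :=
  Submodule.span Kq (Set.range (prodLetters n))

/-- `w = max(u)`: `w` is the lexicographically largest word occurring in `u` with
nonzero coefficient. -/
def IsMaxWord (n : ℕ) (u : F n) (w : List (Fin (n+2))) : Prop :=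
  w ∈ u.support ∧ ∀ v ∈ u.support, v = w ∨ wlt n v w

/-- A word is dominant if it is the largest word of some `u ∈ U`. -/
def IsDominant (n : ℕ) (w : List (Fin (n+2))) : Prop :=
  ∃ u ∈ Ualg n, IsMaxWord n u w

/-- The ascending word `(i, i+1, …, j)` (empty if `j < i`). -/
def asc (n : ℕ) (i j : Fin (n+2)) : List (Fin (n+2)) :=
  (List.finRange (n+2)).filter (fun k => decide (i ≤ k ∧ k ≤ j))

/-- The dominant Lyndon word `ι⁺(α(i,j)) = (i, i+1, …, j)`, for `i ≤ j`. -/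
def lynA (n : ℕ) (i j : Fin (n+2)) : List (Fin (n+2)) := asc n i j

/-- The dominant Lyndon word `ι⁺(β(i,j)) = (i, …, n-1, n, n, n-1, …, j)`, for `i < j`
(the letter `n` of the paper is the last letter of our alphabet `Fin (n+2)`). -/
def lynB (n : ℕ) (i j : Fin (n+2)) : List (Fin (n+2)) :=
  asc n i (Fin.last (n+1)) ++ (asc n j (Fin.last (n+1))).reverse

/-! ### Coefficient functions on words and the shuffle product on them -/

/-- Functions on words; `F n` embeds as the finitely supported ones. -/
abbrev G (n : ℕ) : Type := List (Fin (n+2)) → Kq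

/-- The factor picked up when the letter `a` passes in front of the letter `b`. -/
noncomputable def ff {n : ℕ} (a b : Fin (n+2)) : Kq :=
  (-1) ^ (pa n a * pa n b) * qX ^ (-(cart n a b))

/-- The factor picked up when the letter `a` passes in front of the word `w`. -/
noncomputable def kap {n : ℕ} (a : Fin (n+2)) (w : List (Fin (n+2))) : Kq := (w.map (ff a)).prod

/-- Removal of the prefix `l`. -/
noncomputable def pre {n : ℕ} (l : List (Fin (n+2))) : G n →ₗ[Kq] G n := LinearMap.funLeft Kq Kq (l ++ ·)

/-- Rescaling of every word by its commutation factor with `a`. -/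
noncomputable def tw {n : ℕ} (a : Fin (n+2)) : G n →ₗ[Kq] G n where
  toFun x w := kap a w * x w
  map_add' x y := by ext w; simp [mul_add]
  map_smul' c x := by ext w; simp; ring

/-- The indicator function of a word. -/
noncomputable def del {n : ℕ} (v : List (Fin (n+2))) : G n := fun w => if w = v then 1 else 0

/-- The coefficient of a word in a shuffle product, by recursion on the first letter. -/
noncomputable def shCoeff {n : ℕ} : List (Fin (n+2)) → G n → G n → Kq
  | [], x, y => x [] * y []
  | a :: w, x, y => shCoeff w (pre [a] x) (tw a y) + shCoeff w x (pre [a] y)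

/-- The quantum shuffle product on functions. -/
noncomputable def sh {n : ℕ} : G n →ₗ[Kq] G n →ₗ[Kq] G n :=
  LinearMap.mk₂ Kq (fun x y w => shCoeff w x y)
    (fun x x' y => by
      ext w
      induction w generalizing x x' y with
      | nil => simp [shCoeff, add_mul]
      | cons a w ih => simp only [shCoeff, map_add, Pi.add_apply] at ih ⊢; rw [ih, ih]; ring)
    (fun c x y => by
      ext w
      induction w generalizing x y with
      | nil => simp [shCoeff, mul_assoc]
      | cons a w ih =>
        simp only [shCoeff, map_smul, Pi.smul_apply, smul_eq_mul] at ih ⊢; rw [ih, ih]; ring)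
    (fun x y y' => by
      ext w
      induction w generalizing x y y' with
      | nil => simp [shCoeff, mul_add]
      | cons a w ih => simp only [shCoeff, map_add, Pi.add_apply] at ih ⊢; rw [ih, ih]; ring)
    (fun c x y => by
      ext w
      induction w generalizing x y with
      | nil => simp [shCoeff]; ring
      | cons a w ih =>
        simp only [shCoeff, map_smul, Pi.smul_apply, smul_eq_mul] at ih ⊢; rw [ih, ih]; ring)

section Basic

variable {n : ℕ}

@[simp] theorem pre_apply (l : List (Fin (n+2))) (x : G n) (w : List (Fin (n+2))) :
    pre l x w = x (l ++ w) := rfl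

@[simp] theorem tw_apply (a : Fin (n+2)) (x : G n) (w : List (Fin (n+2))) :
    tw a x w = kap a w * x w := rfl

@[simp] theorem pre_nil (x : G n) : pre [] x = x := rfl

theorem pre_append (l m : List (Fin (n+2))) (x : G n) : pre (l ++ m) x = pre m (pre l x) := by
  ext w; simp

theorem pre_cons (a : Fin (n+2)) (m : List (Fin (n+2))) (x : G n) :
    pre (a :: m) x = pre m (pre [a] x) := pre_append [a] m x

theorem kap_nil (a : Fin (n+2)) : kap a [] = 1 := rfl

theorem kap_cons (a b : Fin (n+2)) (w : List (Fin (n+2))) : kap a (b :: w) = ff a b * kap a w := by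
  simp [kap]

theorem kap_append (a : Fin (n+2)) (v w : List (Fin (n+2))) :
    kap a (v ++ w) = kap a v * kap a w := by
  simp [kap]

theorem kap_perm (a : Fin (n+2)) {v w : List (Fin (n+2))} (h : v.Perm w) : kap a v = kap a w :=
  (h.map _).prod_eq

theorem ff_comm (a b : Fin (n+2)) : ff a b = ff b a := by
  have : cart n a b = cart n b a := by
    unfold cart; by_cases h : a = b
    · subst h; rfl
    · rw [if_neg h, if_neg (Ne.symm h)]; simp only [or_comm]
  rw [ff, ff, this, mul_comm (pa n a)]

theorem qX_ne_zero : qX ≠ 0 := RatFunc.X_ne_zero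

theorem ff_ne_zero (a b : Fin (n+2)) : ff a b ≠ 0 :=
  mul_ne_zero (pow_ne_zero _ (by norm_num)) (zpow_ne_zero _ qX_ne_zero)

theorem kap_ne_zero (a : Fin (n+2)) (w : List (Fin (n+2))) : kap a w ≠ 0 := by
  induction w with
  | nil => simp [kap]
  | cons b w ih => rw [kap_cons]; exact mul_ne_zero (ff_ne_zero _ _) ih

theorem pre_tw (a b : Fin (n+2)) (x : G n) : pre [a] (tw b x) = ff b a • tw b (pre [a] x) := by
  ext w; simp [kap_cons, mul_assoc]

theorem tw_comm (a b : Fin (n+2)) (x : G n) : tw a (tw b x) = tw b (tw a x) := by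
  ext w; simp; ring

theorem sh_nil (x y : G n) : sh x y [] = x [] * y [] := rfl

theorem pre_sh (a : Fin (n+2)) (x y : G n) :
    pre [a] (sh x y) = sh (pre [a] x) (tw a y) + sh x (pre [a] y) := rfl

theorem sh_cons (a : Fin (n+2)) (x y : G n) (w : List (Fin (n+2))) :
    sh x y (a :: w) = sh (pre [a] x) (tw a y) w + sh x (pre [a] y) w := rfl

@[simp] theorem pre_del_nil (a : Fin (n+2)) : pre [a] (del [] : G n) = 0 := by
  ext w; simp [del]

theorem pre_del_cons (a b : Fin (n+2)) (l : List (Fin (n+2))) :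
    pre [a] (del (b :: l)) = if a = b then del l else 0 := by
  ext w; by_cases h : a = b <;> simp [del, h]

theorem pre_del_self (a : Fin (n+2)) (l : List (Fin (n+2))) :
    pre [a] (del (a :: l)) = del l := by
  rw [pre_del_cons, if_pos rfl]

theorem pre_del_ne {a b : Fin (n+2)} (h : a ≠ b) (l : List (Fin (n+2))) :
    pre [a] (del (b :: l)) = 0 := by
  rw [pre_del_cons, if_neg h]

theorem del_self (l : List (Fin (n+2))) : (del l : G n) l = 1 := if_pos rfl

theorem del_ne {v w : List (Fin (n+2))} (h : w ≠ v) : (del v : G n) w = 0 := if_neg h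

theorem tw_del (a : Fin (n+2)) (v : List (Fin (n+2))) : tw a (del v) = kap a v • del v := by
  ext w; by_cases h : w = v <;> simp [del, h]

theorem del_nil_sh (y : G n) : sh (del []) y = y := by
  ext w
  induction w generalizing y with
  | nil => simp [sh_nil, del]
  | cons a w ih => simp [sh_cons, ih]

theorem sh_del_nil (x : G n) : sh x (del []) = x := by
  ext w
  induction w generalizing x with
  | nil => simp [sh_nil, del]
  | cons a w ih => simp [sh_cons, tw_del, kap_nil, ih]

theorem pre_letter_sh (a i : Fin (n+2)) (y : G n) :
    pre [a] (sh (del [i]) y) = (if a = i then tw i y else 0) + sh (del [i]) (pre [a] y) := by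
  rw [pre_sh, pre_del_cons]
  by_cases h : a = i
  · simp [h, del_nil_sh]
  · simp [h]

theorem tw_sh (i : Fin (n+2)) (x y : G n) : tw i (sh x y) = sh (tw i x) (tw i y) := by
  ext w
  induction w generalizing x y with
  | nil => simp [sh_nil, kap_nil]
  | cons a w ih =>
    simp only [tw_apply] at ih
    rw [tw_apply, sh_cons, sh_cons, kap_cons, pre_tw, pre_tw, tw_comm a i]
    simp only [map_smul, LinearMap.smul_apply, Pi.smul_apply, smul_eq_mul, ← ih]
    ring

theorem letter_sh_assoc (i : Fin (n+2)) (x y : G n) :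
    sh (del [i]) (sh x y) = sh (sh (del [i]) x) y := by
  ext w
  induction w generalizing x y with
  | nil => simp [sh_nil, mul_assoc]
  | cons a w ih =>
    rw [sh_cons, sh_cons, pre_sh, pre_letter_sh, pre_del_cons]
    by_cases h : a = i
    · subst h
      simp only [if_true, del_nil_sh, map_add, LinearMap.add_apply, Pi.add_apply, ih, tw_sh]
      ring
    · simp [h, ih]

theorem exists_perm_of_sh_ne_zero {x y : G n} {w : List (Fin (n+2))} (h : sh x y w ≠ 0) :
    ∃ v v', x v ≠ 0 ∧ y v' ≠ 0 ∧ w.Perm (v ++ v') := by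
  induction w generalizing x y with
  | nil =>
    rw [sh_nil] at h
    exact ⟨[], [], left_ne_zero_of_mul h, right_ne_zero_of_mul h, .refl _⟩
  | cons a w ih =>
    rw [sh_cons] at h
    by_cases h1 : sh (pre [a] x) (tw a y) w = 0
    · rw [h1, zero_add] at h
      obtain ⟨v, v', hv, hv', hp⟩ := ih h
      exact ⟨v, a :: v', hv, hv', (hp.cons a).trans List.perm_middle.symm⟩
    · obtain ⟨v, v', hv, hv', hp⟩ := ih h1
      exact ⟨a :: v, v', hv, right_ne_zero_of_mul hv', hp.cons a⟩

/-! ### The subalgebra generated by the letters -/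

/-- Iterated shuffle products of letters, as functions. -/
noncomputable def letterProd : List (Fin (n+2)) → G n
  | [] => del []
  | i :: l => sh (del [i]) (letterProd l)

variable (n) in
/-- The span of the iterated shuffle products of letters. -/
noncomputable def Usub : Submodule Kq (G n) := Submodule.span Kq (Set.range letterProd)

theorem letterProd_mem (l : List (Fin (n+2))) : letterProd l ∈ Usub n :=
  Submodule.subset_span ⟨l, rfl⟩

theorem perm_of_letterProd_ne_zero {l w : List (Fin (n+2))} (h : letterProd l w ≠ 0) :
    w.Perm l := by
  induction l generalizing w with
  | nil =>
    by_contra hw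
    exact h (del_ne fun h' => hw (h' ▸ .refl _))
  | cons i l ih =>
    obtain ⟨v, v', hv, hv', hp⟩ := exists_perm_of_sh_ne_zero h
    have : v = [i] := by by_contra h'; exact hv (del_ne h')
    subst this
    exact hp.trans ((ih hv').cons i)

theorem tw_eq_smul {a : Fin (n+2)} {x : G n} {l : List (Fin (n+2))}
    (h : ∀ w, x w ≠ 0 → w.Perm l) : tw a x = kap a l • x := by
  ext w
  by_cases hw : x w = 0
  · simp [hw]
  · simp [kap_perm a (h w hw)]

theorem letter_sh_mem (i : Fin (n+2)) {y : G n} (hy : y ∈ Usub n) : sh (del [i]) y ∈ Usub n := by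
  induction hy using Submodule.span_induction with
  | mem x hx => obtain ⟨l, rfl⟩ := hx; exact letterProd_mem (i :: l)
  | zero => simp
  | add x y _ _ hx hy => rw [map_add]; exact add_mem hx hy
  | smul c x _ hx => rw [map_smul]; exact Submodule.smul_mem _ _ hx

theorem sh_mem {x y : G n} (hx : x ∈ Usub n) (hy : y ∈ Usub n) : sh x y ∈ Usub n := by
  induction hx using Submodule.span_induction with
  | mem x hx =>
    obtain ⟨l, rfl⟩ := hx
    induction l with
    | nil => rwa [letterProd, del_nil_sh]
    | cons i l ih => rw [letterProd, ← letter_sh_assoc]; exact letter_sh_mem i ih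
  | zero => simp
  | add x y _ _ hx hy => rw [map_add]; exact add_mem hx hy
  | smul c x _ hx => rw [map_smul]; exact Submodule.smul_mem _ _ hx

theorem pre_letter_mem (a : Fin (n+2)) {x : G n} (hx : x ∈ Usub n) : pre [a] x ∈ Usub n := by
  induction hx using Submodule.span_induction with
  | mem x hx =>
    obtain ⟨l, rfl⟩ := hx
    induction l with
    | nil => simp [letterProd]
    | cons i l ih =>
      rw [letterProd, pre_letter_sh]
      refine add_mem ?_ (letter_sh_mem i ih)
      split_ifs
      · rw [tw_eq_smul fun _ => perm_of_letterProd_ne_zero]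
        exact Submodule.smul_mem _ _ (letterProd_mem l)
      · exact zero_mem _
  | zero => simp
  | add x y _ _ hx hy => rw [map_add]; exact add_mem hx hy
  | smul c x _ hx => rw [map_smul]; exact Submodule.smul_mem _ _ hx

theorem pre_mem (l : List (Fin (n+2))) {x : G n} (hx : x ∈ Usub n) : pre l x ∈ Usub n := by
  induction l generalizing x with
  | nil => exact hx
  | cons a l ih => rw [pre_cons]; exact ih (pre_letter_mem a hx)

/-- The homogeneous components of an element of `Usub` lie in `Usub`. -/
theorem component_mem (v : List (Fin (n+2))) {x : G n} (hx : x ∈ Usub n) :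
    (fun w => if w.Perm v then x w else 0) ∈ Usub n := by
  induction hx using Submodule.span_induction with
  | mem x hx =>
    obtain ⟨l, rfl⟩ := hx
    by_cases hl : l.Perm v
    · convert letterProd_mem l using 1
      ext w
      split_ifs with hw
      · rfl
      · by_contra h
        exact hw ((perm_of_letterProd_ne_zero (Ne.symm h)).trans hl)
    · convert zero_mem (Usub n) using 1
      ext w
      split_ifs with hw
      · by_contra h
        exact hl ((perm_of_letterProd_ne_zero h).symm.trans hw)
      · rfl
  | zero => convert zero_mem (Usub n) using 1; ext w; simp
  | add x y _ _ hx hy => convert add_mem hx hy using 1; ext w; simp; split_ifs <;> simp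
  | smul c x _ hx => convert Submodule.smul_mem _ c hx using 1; ext w; simp

end Basic

section Comparison

variable {n : ℕ}

/-- The shuffle of a letter with a word, by recursion on the first letter. -/
noncomputable def ins (i : Fin (n+2)) : List (Fin (n+2)) → F n
  | [] => Finsupp.single [i] 1
  | b :: y => Finsupp.single (i :: b :: y) (kap i (b :: y)) + Finsupp.mapDomain (List.cons b) (ins i y)

theorem ins_concat (i j : Fin (n+2)) (y : List (Fin (n+2))) :
    ins i (y ++ [j]) =
      Finsupp.single (y ++ [j, i]) 1 + ff i j • Finsupp.mapDomain (· ++ [j]) (ins i y) := by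
  induction y with
  | nil =>
    simp [ins, kap_cons, kap_nil, Finsupp.mapDomain_single, add_comm]
  | cons b y ih =>
    rw [List.cons_append, ins, ih, ins]
    simp only [Finsupp.mapDomain_add, Finsupp.mapDomain_smul, Finsupp.mapDomain_single,
      ← Finsupp.mapDomain_comp, smul_add, Finsupp.smul_single, smul_eq_mul]
    have h1 : kap i (b :: (y ++ [j])) = ff i j * kap i (b :: y) := by
      rw [← List.cons_append, kap_append, kap_cons i j, kap_nil]; ring
    rw [h1]
    have h2 : (List.cons b ∘ fun x => x ++ [j]) = (fun x => x ++ [j]) ∘ List.cons b := by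
      ext1 x; simp
    rw [h2]
    simp only [List.cons_append]
    abel

theorem shAux_letter_factor (i j : Fin (n+2)) :
    (-1 : Kq) ^ (pw n [i] * pa n j) * qX ^ (-(bil n (wt n [i]) (wt n [j]))) = ff i j := by
  have : bil n (wt n [i]) (wt n [j]) = cart n i j := by
    simp only [bil, wt, List.count_singleton, beq_iff_eq]
    rw [Finset.sum_eq_single i, Finset.sum_eq_single j] <;> simp +contextual [eq_comm]
  rw [this, ff]
  simp [pw]

theorem mapDomain_reverse_shAux (i : Fin (n+2)) (y : List (Fin (n+2))) :
    Finsupp.mapDomain List.reverse (shAux n [i] y) = ins i y.reverse := by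
  induction y with
  | nil => simp [shAux, ins, Finsupp.mapDomain_single]
  | cons j y ih =>
    rw [shAux, shAux_letter_factor, List.reverse_cons, ins_concat, ← ih]
    simp only [shAux, Finsupp.mapDomain_add, Finsupp.mapDomain_smul, Finsupp.mapDomain_single,
      ← Finsupp.mapDomain_comp]
    congr 3
    · simp
    · ext1 x; simp

theorem shw_letter (i : Fin (n+2)) (y : List (Fin (n+2))) : shw n [i] y = ins i y := by
  rw [shw, List.reverse_singleton, mapDomain_reverse_shAux, List.reverse_reverse]

theorem coe_single (v : List (Fin (n+2))) : (⇑(Finsupp.single v (1 : Kq)) : G n) = del v := by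
  ext w; simp [Finsupp.single_apply, del, eq_comm]

theorem coe_ins (i : Fin (n+2)) (y : List (Fin (n+2))) :
    (⇑(ins i y) : G n) = sh (del [i]) (del y) := by
  induction y with
  | nil => rw [ins, coe_single, sh_del_nil]
  | cons b y ih =>
    ext w
    rw [ins, Finsupp.add_apply]
    cases w with
    | nil =>
      rw [sh_nil, del_ne (v := [i]) (by simp), zero_mul, Finsupp.single_apply, if_neg (by simp),
        Finsupp.mapDomain_of_notMem_range _ _ (by simp), add_zero]
    | cons a w =>
      have := congrFun (pre_letter_sh a i (del (b :: y))) w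
      rw [pre_apply, List.singleton_append] at this
      rw [this, pre_del_cons, Pi.add_apply]
      congr 1
      · by_cases h : i = a
        · subst h
          simp only [Finsupp.single_apply, List.cons.injEq, true_and, if_true, tw_apply, del]
          by_cases h' : b :: y = w
          · subst h'; simp
          · simp [h', Ne.symm h']
        · rw [if_neg (Ne.symm h), Finsupp.single_apply, if_neg (by simp [h])]; rfl
      · by_cases h : a = b
        · subst h
          rw [if_pos rfl, Finsupp.mapDomain_apply (List.cons_injective), ih]
        · rw [if_neg h, Finsupp.mapDomain_of_notMem_range _ _ (by simp [Ne.symm h]), map_zero]; rfl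

theorem coe_diam_letter (i : Fin (n+2)) (v : F n) :
    (⇑(diam n (Finsupp.single [i] 1) v) : G n) = sh (del [i]) ⇑v := by
  rw [diam, Finsupp.sum_single_index (by simp)]
  have : (Finsupp.lcoeFun : F n →ₗ[Kq] G n) (v.sum fun y cy => (1 * cy) • shw n [i] y)
      = sh (del [i]) (Finsupp.lcoeFun (R := Kq) v) := by
    conv_rhs => rw [← Finsupp.sum_single v]
    simp only [Finsupp.sum, map_sum]
    refine Finset.sum_congr rfl fun y _ => ?_
    rw [one_mul, map_smul, shw_letter]
    have h : Finsupp.single y (v y) = v y • Finsupp.single y (1 : Kq) := by simp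
    rw [h, map_smul, map_smul]
    exact congrArg _ ((coe_ins i y).trans (by rw [← coe_single y]; rfl))
  exact this

theorem coe_prodLetters (l : List (Fin (n+2))) : (⇑(prodLetters n l) : G n) = letterProd l := by
  induction l with
  | nil => exact coe_single _
  | cons i l ih => rw [prodLetters, coe_diam_letter, ih, letterProd]

theorem map_Ualg : (Ualg n).map (Finsupp.lcoeFun : F n →ₗ[Kq] G n) = Usub n := by
  rw [Ualg, Submodule.map_span, Usub, ← Set.range_comp]
  congr 2
  ext1 l
  exact coe_prodLetters l

/-- `w` is the largest word of the function `x`. -/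
def IsMaxOf (x : G n) (w : List (Fin (n+2))) : Prop :=
  x w ≠ 0 ∧ ∀ v, x v ≠ 0 → v = w ∨ wlt n v w

theorem isDominant_iff {w : List (Fin (n+2))} :
    IsDominant n w ↔ ∃ x ∈ Usub n, IsMaxOf x w := by
  simp only [IsDominant, ← map_Ualg, Submodule.mem_map, IsMaxWord, IsMaxOf, Finsupp.mem_support_iff]
  constructor
  · rintro ⟨u, hu, h⟩
    exact ⟨_, ⟨u, hu, rfl⟩, h⟩
  · rintro ⟨_, ⟨u, hu, rfl⟩, h⟩
    exact ⟨u, hu, h⟩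

theorem IsDominant.exists_homogeneous {w : List (Fin (n+2))} (h : IsDominant n w) :
    ∃ x ∈ Usub n, IsMaxOf x w ∧ ∀ v, x v ≠ 0 → v.Perm w := by
  obtain ⟨x, hx, hw, hmax⟩ := isDominant_iff.1 h
  refine ⟨_, component_mem w hx, ⟨by simpa using hw, fun v hv => hmax v ?_⟩, fun v hv => ?_⟩
  · simp only [ne_eq, ite_eq_right_iff, not_forall] at hv; exact hv.2
  · simp only [ne_eq, ite_eq_right_iff, not_forall] at hv; exact hv.1

end Comparison

section Serre

variable {n : ℕ}

theorem ff_far {a b : Fin (n+2)} (h : (a : ℕ) + 1 < b ∨ (b : ℕ) + 1 < a) : ff a b = 1 := by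
  have hab : a ≠ b := by rintro rfl; omega
  have h1 : pa n a * pa n b = 0 := by
    have := a.2; have := b.2
    unfold pa; split_ifs <;> first | rfl | omega
  rw [ff, h1, cart, if_neg hab, if_neg (by omega)]; simp

theorem ff_adj {a b : Fin (n+2)} (h : (a : ℕ) + 1 = b ∨ (b : ℕ) + 1 = a) : ff a b = qX ^ 2 := by
  have hab : a ≠ b := by rintro rfl; omega
  have h1 : pa n a * pa n b = 0 := by
    have := a.2; have := b.2
    unfold pa; split_ifs <;> first | rfl | omega
  rw [ff, h1, cart, if_neg hab, if_pos h]; norm_cast; simp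

theorem ff_even {a : Fin (n+2)} (h : (a : ℕ) < n + 1) : ff a a = (qX⁻¹) ^ 4 := by
  rw [ff, pa, if_neg h.ne, cart, if_pos rfl, if_neg h.ne, zpow_neg, inv_pow]; norm_cast; simp

theorem ff_odd {a : Fin (n+2)} (h : (a : ℕ) = n + 1) : ff a a = -(qX⁻¹) ^ 2 := by
  rw [ff, pa, if_pos h, cart, if_pos rfl, if_pos h, zpow_neg, inv_pow]; norm_cast; simp

theorem qX_pow_ne_one {k : ℕ} (hk : 0 < k) : qX ^ k ≠ 1 := by
  intro h
  have h1 : algebraMap (Polynomial ℚ) Kq (Polynomial.X ^ k) = algebraMap (Polynomial ℚ) Kq 1 := by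
    rw [map_pow, RatFunc.algebraMap_X, map_one]; exact h
  have h2 := congrArg Polynomial.natDegree (RatFunc.algebraMap_injective ℚ h1)
  simp at h2
  omega

/-- The quantum integer `[2]` attached to an even letter. -/
noncomputable def q2 : Kq := qX ^ 2 + qX⁻¹ ^ 2

theorem q2_ne_zero : q2 ≠ 0 := by
  intro h
  have h0 := qX_ne_zero
  rw [q2] at h
  field_simp at h
  refine qX_pow_ne_one (k := 8) (by norm_num) ?_
  linear_combination (qX ^ 4 - 1) * h

/-- The quantum integer `[3]` attached to the odd letter. -/
noncomputable def q3 : Kq := 1 - qX⁻¹ ^ 2 + qX⁻¹ ^ 4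

theorem q3_ne_zero : q3 ≠ 0 := by
  intro h
  have h0 := qX_ne_zero
  rw [q3] at h
  field_simp at h
  refine qX_pow_ne_one (k := 12) (by norm_num) ?_
  linear_combination (qX ^ 2 + 1) * (qX ^ 6 - 1) * h

theorem pre_pair (a b : Fin (n+2)) (x : G n) : pre [a, b] x = pre [b] (pre [a] x) := pre_cons _ _ _

theorem pre_letter_ind {P : G n → Prop} {x : G n} (hx : x ∈ Usub n) (h0 : P (del []))
    (hs : ∀ i y, P y → P (sh (del [i]) y)) (hadd : ∀ x y, P x → P y → P (x + y))
    (hsmul : ∀ (c : Kq) x, P x → P (c • x)) : P x := by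
  induction hx using Submodule.span_induction with
  | mem x hx =>
    obtain ⟨l, rfl⟩ := hx
    induction l with
    | nil => exact h0
    | cons i l ih => exact hs i _ ih
  | zero => simpa using hsmul 0 _ h0
  | add x y _ _ hx hy => exact hadd _ _ hx hy
  | smul c x _ hx => exact hsmul _ _ hx

theorem pre_comm {a b : Fin (n+2)} (h : (a : ℕ) + 1 < b ∨ (b : ℕ) + 1 < a) {x : G n}
    (hx : x ∈ Usub n) : pre [a, b] x = pre [b, a] x := by
  simp only [pre_pair]
  refine pre_letter_ind (P := fun x => pre [b] (pre [a] x) = pre [a] (pre [b] x)) hx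
    (by simp) (fun i y hy => ?_) (fun x y hx hy => ?_) (fun c x hx => ?_)
  · have hab : a ≠ b := by rintro rfl; omega
    simp only [pre_letter_sh, map_add, hy]
    by_cases h1 : a = i
    · subst h1; simp [hab.symm, pre_tw, ff_far h]
    by_cases h2 : b = i
    · subst h2; simp [hab, pre_tw, ff_far h.symm]
    simp [h1, h2]
  · simp only [map_add, hx, hy]
  · simp only [map_smul, hx]

theorem pre_serre {a b : Fin (n+2)} (h : (a : ℕ) + 1 = b ∨ (b : ℕ) + 1 = a) (ha : (a : ℕ) < n + 1)
    {x : G n} (hx : x ∈ Usub n) : pre [a, a, b] x - q2 • pre [a, b, a] x + pre [b, a, a] x = 0 := by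
  simp only [pre_cons a (_ :: _), pre_cons b (_ :: _)]
  refine pre_letter_ind
    (P := fun x => pre [b] (pre [a] (pre [a] x)) - q2 • pre [a] (pre [b] (pre [a] x))
      + pre [a] (pre [a] (pre [b] x)) = 0) hx
    (by simp) (fun i y hy => ?_) (fun x y hx hy => ?_) (fun c x hx => ?_)
  · have hab : a ≠ b := by rintro rfl; omega
    have h0 := qX_ne_zero
    have hy' := congrArg (sh (del [i])) hy
    simp only [map_add, map_sub, map_smul, map_zero] at hy'
    simp only [pre_letter_sh, map_add, smul_add]
    ext w
    have hw := congrFun hy' w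
    simp only [Pi.add_apply, Pi.sub_apply, Pi.smul_apply, smul_eq_mul, Pi.zero_apply] at hw ⊢
    have hq : qX ^ 2 * qX⁻¹ ^ 2 = 1 := by rw [← mul_pow, mul_inv_cancel₀ h0, one_pow]
    by_cases h1 : a = i
    · subst h1
      simp only [if_true, if_neg hab.symm, pre_tw, ff_adj h, ff_even ha, q2, map_smul,
        Pi.smul_apply, smul_eq_mul, map_zero, Pi.zero_apply] at hw ⊢
      linear_combination (norm := (field_simp; ring)) hw
    by_cases h2 : b = i
    · subst h2
      simp only [if_true, if_neg hab, pre_tw, ff_adj h.symm, q2, map_smul,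
        Pi.smul_apply, smul_eq_mul, map_zero, Pi.zero_apply] at hw ⊢
      linear_combination hw - tw b (pre [a] (pre [a] y)) w * hq
    simp only [if_neg h1, if_neg h2, map_zero, Pi.zero_apply]
    linear_combination hw
  · simp only [map_add, smul_add]
    linear_combination hx + hy
  · simp only [map_smul, smul_comm q2 c]
    rw [← smul_sub, ← smul_add, hx, smul_zero]

theorem pre_serre_odd {a b : Fin (n+2)} (h : (b : ℕ) + 1 = a) (ha : (a : ℕ) = n + 1)
    {x : G n} (hx : x ∈ Usub n) :
    pre [a, a, a, b] x - (q3 * qX ^ 2) • pre [a, a, b, a] x - (q3 * qX ^ 2) • pre [a, b, a, a] x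
      + pre [b, a, a, a] x = 0 := by
  simp only [pre_cons a (_ :: _), pre_cons b (_ :: _)]
  refine pre_letter_ind
    (P := fun x => pre [b] (pre [a] (pre [a] (pre [a] x)))
      - (q3 * qX ^ 2) • pre [a] (pre [b] (pre [a] (pre [a] x)))
      - (q3 * qX ^ 2) • pre [a] (pre [a] (pre [b] (pre [a] x)))
      + pre [a] (pre [a] (pre [a] (pre [b] x))) = 0) hx
    (by simp) (fun i y hy => ?_) (fun x y hx hy => ?_) (fun c x hx => ?_)
  · have hab : a ≠ b := by rintro rfl; omega
    have h0 := qX_ne_zero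
    have hy' := congrArg (sh (del [i])) hy
    simp only [map_add, map_sub, map_smul, map_zero] at hy'
    simp only [pre_letter_sh, map_add, smul_add]
    ext w
    have hw := congrFun hy' w
    simp only [Pi.add_apply, Pi.sub_apply, Pi.smul_apply, smul_eq_mul, Pi.zero_apply] at hw ⊢
    by_cases h1 : a = i
    · subst h1
      simp only [if_true, if_neg hab.symm, pre_tw, ff_adj (.inr h), ff_odd ha,
        map_smul, Pi.smul_apply, smul_eq_mul, map_zero, Pi.zero_apply, q3] at hw ⊢
      linear_combination (norm := (field_simp; ring)) hw
    by_cases h2 : b = i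
    · subst h2
      simp only [if_true, if_neg hab, pre_tw, ff_adj (.inl h), q3, map_smul,
        Pi.smul_apply, smul_eq_mul, map_zero, Pi.zero_apply] at hw ⊢
      linear_combination (norm := (field_simp; ring)) hw
    simp only [if_neg h1, if_neg h2, map_zero, Pi.zero_apply]
    linear_combination hw
  · simp only [map_add, smul_add]
    linear_combination hx + hy
  · simp only [map_smul, smul_comm (q3 * qX ^ 2) c]
    rw [← smul_sub, ← smul_sub, ← smul_add, hx, smul_zero]

end Serre

section Words

variable {n : ℕ}

theorem mem_asc {i j a : Fin (n+2)} : a ∈ asc n i j ↔ i ≤ a ∧ a ≤ j := by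
  simp [asc]

theorem asc_sorted (i j : Fin (n+2)) : (asc n i j).Pairwise (· < ·) :=
  (List.pairwise_lt_finRange _).filter _

theorem asc_self (i : Fin (n+2)) : asc n i i = [i] :=
  (asc_sorted i i).eq_of_mem_iff (List.pairwise_singleton _ _) fun {a} => by
    rw [mem_asc, List.mem_singleton]; omega

theorem asc_concat {i k k' : Fin (n+2)} (h : i ≤ k) (hk : (k : ℕ) + 1 = k') :
    asc n i k' = asc n i k ++ [k'] := by
  refine (asc_sorted i k').eq_of_mem_iff (List.pairwise_append.2
    ⟨asc_sorted i k, List.pairwise_singleton _ _, fun a ha b hb => ?_⟩) fun {a} => ?_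
  · rw [mem_asc] at ha; rw [List.mem_singleton] at hb; omega
  · rw [List.mem_append, mem_asc, mem_asc, List.mem_singleton]; omega

theorem asc_cons {i i' k : Fin (n+2)} (h : i' ≤ k) (hi : (i : ℕ) + 1 = i') :
    asc n i k = i :: asc n i' k := by
  refine (asc_sorted i k).eq_of_mem_iff (List.pairwise_cons.2
    ⟨fun a ha => ?_, asc_sorted i' k⟩) fun {a} => ?_
  · rw [mem_asc] at ha; omega
  · rw [List.mem_cons, mem_asc, mem_asc]; omega

theorem lynB_last (i : Fin (n+2)) :
    lynB n i (Fin.last (n+1)) = asc n i (Fin.last (n+1)) ++ [Fin.last (n+1)] := by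
  rw [lynB, asc_self]; rfl

theorem lynB_concat (i : Fin (n+2)) {c c' : Fin (n+2)} (hc : (c : ℕ) + 1 = c') :
    lynB n i c = lynB n i c' ++ [c] := by
  rw [lynB, lynB, asc_cons (Fin.le_last _) hc]; simp

@[elab_as_elim]
theorem ascending_induction {i : Fin (n+2)} {P : ∀ k, i ≤ k → Prop} (base : P i le_rfl)
    (step : ∀ (k k' : Fin (n+2)) (hk : i ≤ k) (hkk : (k : ℕ) + 1 = k'),
      P k hk → P k' (hk.trans (Fin.le_def.2 (by omega)))) {k : Fin (n+2)} (hk : i ≤ k) : P k hk := by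
  obtain ⟨k, hk'⟩ := k
  induction k with
  | zero =>
    obtain rfl : i = ⟨0, hk'⟩ := le_antisymm hk (Nat.zero_le _)
    exact base
  | succ k ih =>
    rcases hk.eq_or_lt with rfl | h
    · exact base
    · exact step ⟨k, by omega⟩ _ (Nat.lt_succ_iff.1 h) rfl (ih _ _)

@[elab_as_elim]
theorem descending_induction {i : Fin (n+2)} {P : ∀ c, i < c → Prop}
    (base : ∀ h : i < Fin.last (n+1), P (Fin.last (n+1)) h)
    (step : ∀ (c c' : Fin (n+2)) (hc : i < c) (hcc : (c : ℕ) + 1 = c'),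
      P c' (hc.trans (Fin.lt_def.2 (by omega))) → P c hc) {c : Fin (n+2)} (hc : i < c) : P c hc := by
  induction hd : n + 1 - c using Nat.strong_induction_on generalizing c with
  | _ d ih =>
    rcases (Fin.le_last c).eq_or_lt with rfl | h
    · exact base hc
    · have h' : (c : ℕ) < n + 1 := h
      exact step c ⟨c + 1, by omega⟩ hc rfl (ih _ (by simp only; omega) _ rfl)

end Words

section Vanishing

variable {n : ℕ}

/-- `x` lies in the subalgebra and all its nonempty words start with `i`. -/
structure Lead (i : Fin (n+2)) (x : G n) : Prop where
  mem : x ∈ Usub n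
  pre_eq_zero : ∀ a, a ≠ i → pre [a] x = 0

theorem pre_swap (l : List (Fin (n+2))) {a b : Fin (n+2)}
    (h : (a : ℕ) + 1 < b ∨ (b : ℕ) + 1 < a) {x : G n} (hx : x ∈ Usub n) :
    pre (l ++ [a, b]) x = pre (l ++ [b, a]) x := by
  rw [pre_append, pre_append, pre_comm h (pre_mem l hx)]

theorem pre_append_eq_zero {l : List (Fin (n+2))} {x : G n} (h : pre l x = 0)
    (m : List (Fin (n+2))) : pre (l ++ m) x = 0 := by
  rw [pre_append, h, map_zero]

variable {i : Fin (n+2)} {x : G n}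

theorem Lead.asc_init (hx : Lead i x) {k : Fin (n+2)} (hk : i ≤ k) :
    ∃ l, asc n i k = l ++ [k] ∧ ∀ a, k < a → pre (l ++ [a]) x = 0 := by
  induction hk using ascending_induction with
  | base => exact ⟨[], asc_self i, fun a ha => hx.pre_eq_zero a ha.ne'⟩
  | step k k' hk hkk ih =>
    obtain ⟨l, hl, hz⟩ := ih
    refine ⟨asc n i k, asc_concat hk hkk, fun a ha => ?_⟩
    have h := pre_append_eq_zero (hz a (by omega)) [k]
    rw [List.append_assoc, List.singleton_append, pre_swap l (by omega) hx.mem] at h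
    rw [hl, List.append_assoc]
    exact h

theorem Lead.asc_vanish (hx : Lead i x) {k : Fin (n+2)} (hk : i ≤ k) (a : Fin (n+2)) (ha : i < a)
    (hak : (a : ℕ) ≠ k + 1) (hlast : ¬(a = k ∧ (k : ℕ) = n + 1)) :
    pre (asc n i k ++ [a]) x = 0 := by
  have far : ∀ k, i ≤ k → (k : ℕ) + 1 < a → pre (asc n i k ++ [a]) x = 0 := by
    intro k hk hka
    obtain ⟨l, hl, hz⟩ := hx.asc_init hk
    have h := pre_append_eq_zero (hz a (by omega)) [k]
    rw [List.append_assoc, List.singleton_append, ← pre_swap l (.inl hka) hx.mem] at h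
    rw [hl, List.append_assoc]
    exact h
  induction hk using ascending_induction generalizing a with
  | base => exact far i le_rfl (by omega)
  | step k k' hk hkk ih =>
    by_cases hfar : (k' : ℕ) + 1 < a
    · exact far k' (by omega) hfar
    rw [asc_concat hk hkk, List.append_assoc, List.singleton_append]
    obtain ⟨l, hl, hz⟩ := hx.asc_init hk
    have hk' := k'.2
    rcases lt_trichotomy a k with h | rfl | h
    · rw [← pre_swap _ (.inl (by omega)) hx.mem, ← List.singleton_append, ← List.append_assoc]
      exact pre_append_eq_zero (ih a ha (by omega) (by omega) (by omega)) _
    · have hs := pre_serre (.inl hkk) (by omega) (pre_mem l hx.mem)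
      have h1 : pre [a, a, k'] (pre l x) = 0 := by
        have := pre_append_eq_zero (ih a ha (by omega) (by omega) (by omega)) [k']
        simpa [hl, ← pre_append] using this
      have h2 : pre [k', a, a] (pre l x) = 0 := by
        simpa [← pre_append] using pre_append_eq_zero (hz k' (by omega)) [a, a]
      rw [h1, h2, zero_sub, add_zero, neg_eq_zero, smul_eq_zero, or_iff_right q2_ne_zero] at hs
      simpa [hl, ← pre_append] using hs
    · obtain rfl : a = k' := by omega
      have hs := pre_serre (.inr hkk) (by omega) (pre_mem l hx.mem)
      have h0 := hz a (by omega)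
      have h1 : pre [a, a, k] (pre l x) = 0 := by
        simpa [← pre_append] using pre_append_eq_zero h0 [a, k]
      have h2 : pre [a, k, a] (pre l x) = 0 := by
        simpa [← pre_append] using pre_append_eq_zero h0 [k, a]
      rw [h1, h2, smul_zero, sub_zero, zero_add] at hs
      simpa [hl, ← pre_append] using hs

end Vanishing

section Lex

variable {n : ℕ}

theorem wlt_cons {a b : Fin (n+2)} {v w : List (Fin (n+2))} :
    wlt n (a :: v) (b :: w) ↔ a < b ∨ a = b ∧ wlt n v w :=
  List.cons_lex_cons_iff

theorem wlt_append_left {p v w : List (Fin (n+2))} : wlt n (p ++ v) (p ++ w) ↔ wlt n v w := by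
  induction p with
  | nil => rfl
  | cons a p ih => simp [wlt_cons, ih]

theorem wlt_asymm {v w : List (Fin (n+2))} (h : wlt n v w) : ¬wlt n w v := by
  unfold wlt at h ⊢
  exact asymm h

/-- The first difference between `w` and `u`. -/
theorem exists_prefix_or_lt_or_gt (w u : List (Fin (n+2))) :
    (∃ s, w = u ++ s) ∨ (∀ s, wlt n w (u ++ s)) ∨
      ∃ l e r c u', w = l ++ e :: r ∧ u = l ++ c :: u' ∧ c < e := by
  induction u generalizing w with
  | nil => exact .inl ⟨w, rfl⟩
  | cons c u ih =>
    obtain _ | ⟨e, r⟩ := w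
    · exact .inr (.inl fun s => List.Lex.nil)
    rcases lt_trichotomy e c with h | rfl | h
    · exact .inr (.inl fun s => wlt_cons.2 (.inl h))
    · rcases ih r with ⟨s, rfl⟩ | h | ⟨l, e', r', c', u', rfl, rfl, h⟩
      · exact .inl ⟨s, rfl⟩
      · exact .inr (.inl fun s => wlt_cons.2 (.inr ⟨rfl, h s⟩))
      · exact .inr (.inr ⟨e :: l, e', r', c', u', rfl, rfl, h⟩)
    · exact .inr (.inr ⟨[], e, r, c, u, rfl, rfl, h⟩)

end Lex

section Blocks

variable {n : ℕ} {i : Fin (n+2)} {x : G n}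

theorem Lead.lynB_last_vanish (hx : Lead i x) (hi : i < Fin.last (n+1)) (a : Fin (n+2))
    (ha : i < a) (hac : (a : ℕ) + 1 ≠ n + 1) :
    pre (lynB n i (Fin.last (n+1)) ++ [a]) x = 0 := by
  have hi' : (i : ℕ) < n + 1 := hi
  have ha' := a.2
  have hM : i ≤ (⟨n, by omega⟩ : Fin (n+2)) := Fin.le_def.2 (Nat.lt_succ_iff.1 hi')
  have hML : ((⟨n, by omega⟩ : Fin (n+2)) : ℕ) + 1 = Fin.last (n+1) := rfl
  rw [lynB_last, List.append_assoc, List.singleton_append]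
  by_cases haL : a = Fin.last (n+1)
  · subst haL
    obtain ⟨l, hl, hz⟩ := hx.asc_init hM
    have h0 := hz (Fin.last (n+1)) (Fin.lt_def.2 (Nat.lt_succ_self n))
    have hs := pre_serre_odd hML rfl (pre_mem l hx.mem)
    have h1 (m) : pre (Fin.last (n+1) :: m) (pre l x) = 0 := by
      simpa [← pre_append] using pre_append_eq_zero h0 m
    rw [h1, h1, h1, smul_zero, sub_zero, sub_zero, zero_add] at hs
    rw [asc_concat hM hML, hl]
    simpa [← pre_append] using hs
  · have haL' : (a : ℕ) ≠ n + 1 := fun h => haL (Fin.ext h)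
    rw [← pre_swap _ (.inl (by rw [Fin.val_last]; omega)) hx.mem, ← List.singleton_append,
      ← List.append_assoc]
    exact pre_append_eq_zero (hx.asc_vanish (Fin.le_last _) a ha
      (by rw [Fin.val_last]; omega) (by tauto)) _

theorem Lead.lynB_vanish (hx : Lead i x) {c : Fin (n+2)} (hc : i < c) :
    (∃ l, lynB n i c = l ++ [c] ∧ ∀ a, i < a → a < c → pre (l ++ [a]) x = 0) ∧
      ∀ a, i < a → (a : ℕ) + 1 ≠ c → pre (lynB n i c ++ [a]) x = 0 := by
  induction hc using descending_induction with
  | base hi =>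
    refine ⟨⟨_, lynB_last i, fun a ha haL => ?_⟩, hx.lynB_last_vanish hi⟩
    exact hx.asc_vanish (Fin.le_last _) a ha (by rw [Fin.val_last]; omega)
      (fun h => haL.ne h.1)
  | step c c' hc hcc ih =>
    obtain ⟨⟨l, hl, hz⟩, hv⟩ := ih
    refine ⟨⟨_, lynB_concat i hcc, fun a ha hac => hv a ha (by omega)⟩, fun a ha hac => ?_⟩
    have hc' := c'.2
    rw [lynB_concat i hcc, List.append_assoc, List.singleton_append]
    have h0 (m) : pre (c :: m) (pre l x) = 0 := by
      simpa [← pre_append] using pre_append_eq_zero (hz c hc (by omega)) m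
    by_cases hac' : a = c
    · subst hac'
      have hs := pre_serre (.inl hcc) (by omega) (pre_mem l hx.mem)
      rw [h0, h0, smul_zero, sub_zero, zero_add] at hs
      simpa [hl, ← pre_append] using hs
    by_cases hac'' : a = c'
    · subst hac''
      by_cases haL : (a : ℕ) = n + 1
      · obtain rfl : a = Fin.last (n+1) := Fin.ext haL
        have hs := pre_serre_odd hcc rfl (pre_mem (asc n i c) hx.mem)
        have hasc := asc_concat hc.le hcc
        have h1 : pre [Fin.last (n+1), Fin.last (n+1), Fin.last (n+1), c] (pre (asc n i c) x) = 0 := by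
          have := pre_append_eq_zero (hv (Fin.last (n+1)) (by omega) (by simp)) [c]
          simpa [lynB_last, hasc, ← pre_append] using this
        have h2 : pre [Fin.last (n+1), c, Fin.last (n+1), Fin.last (n+1)] (pre (asc n i c) x) = 0 := by
          have := pre_append_eq_zero (hx.asc_vanish (Fin.le_last _) c hc
            (by rw [← hcc]; omega) (by rintro ⟨rfl, -⟩; omega)) [Fin.last (n+1), Fin.last (n+1)]
          simpa [hasc, ← pre_append] using this
        have h3 : pre [c, Fin.last (n+1), Fin.last (n+1), Fin.last (n+1)] (pre (asc n i c) x) = 0 := by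
          have := pre_append_eq_zero (hx.asc_vanish hc.le c hc
            (by omega) (by omega)) [Fin.last (n+1), Fin.last (n+1), Fin.last (n+1)]
          simpa [← pre_append] using this
        have hne : q3 * qX ^ 2 ≠ 0 := mul_ne_zero q3_ne_zero (pow_ne_zero _ qX_ne_zero)
        rw [h1, h2, h3, zero_sub, smul_zero, sub_zero, add_zero, neg_eq_zero, smul_eq_zero,
          or_iff_right hne] at hs
        simpa [lynB_last, hasc, ← pre_append] using hs
      · have hs := pre_serre (.inr hcc) (by omega) (pre_mem l hx.mem)
        have h1 : pre [a, a, c] (pre l x) = 0 := by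
          simpa [hl, ← pre_append] using pre_append_eq_zero (hv a (by omega) (by omega)) [c]
        rw [h1, h0, zero_sub, add_zero, neg_eq_zero, smul_eq_zero, or_iff_right q2_ne_zero] at hs
        simpa [hl, ← pre_append] using hs
    · rw [← pre_swap _ (by omega) hx.mem, ← List.singleton_append, ← List.append_assoc]
      exact pre_append_eq_zero (hv a ha (by omega)) _

/-- The dominant Lyndon words starting with `i`. -/
def Block (i : Fin (n+2)) (p : List (Fin (n+2))) : Prop :=
  (∃ k, i ≤ k ∧ p = asc n i k) ∨ ∃ c, i < c ∧ p = lynB n i c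

theorem Lead.eq_or_block_concat (hx : Lead i x) {p : List (Fin (n+2))} (hp : Block i p)
    {a : Fin (n+2)} (ha : i ≤ a) (h : pre (p ++ [a]) x ≠ 0) : a = i ∨ Block i (p ++ [a]) := by
  refine or_iff_not_imp_left.2 fun hai => ?_
  have ha : i < a := lt_of_le_of_ne ha (Ne.symm hai)
  rcases hp with ⟨k, hk, rfl⟩ | ⟨c, hc, rfl⟩
  · by_cases hak : (a : ℕ) = k + 1
    · exact .inl ⟨a, ha.le, (asc_concat hk hak.symm).symm⟩
    by_cases hlast : a = k ∧ (k : ℕ) = n + 1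
    · obtain ⟨rfl, h'⟩ := hlast
      obtain rfl : a = Fin.last (n+1) := Fin.ext h'
      exact .inr ⟨_, ha, (lynB_last i).symm⟩
    · exact absurd (hx.asc_vanish hk a ha hak hlast) h
  · by_cases hac : (a : ℕ) + 1 = c
    · exact .inr ⟨a, ha, (lynB_concat i hac).symm⟩
    · exact absurd ((hx.lynB_vanish hc).2 a ha hac) h

theorem Lead.exists_block_prefix (hx : Lead i x) (hge : ∀ v, x v ≠ 0 → ∀ b ∈ v, i ≤ b)
    {v : List (Fin (n+2))} (hv : x v ≠ 0) (hne : v ≠ []) :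
    ∃ p s, Block i p ∧ v = p ++ s ∧ (s = [] ∨ ∃ t, s = i :: t) := by
  have key : ∀ s p, Block i p → x (p ++ s) ≠ 0 →
      ∃ p' s', Block i p' ∧ p ++ s = p' ++ s' ∧ (s' = [] ∨ ∃ t, s' = i :: t) := by
    intro s
    induction s with
    | nil => exact fun p hp _ => ⟨p, [], hp, rfl, .inl rfl⟩
    | cons a s ih =>
      intro p hp hv
      have hne : pre (p ++ [a]) x ≠ 0 := fun h => hv (by simpa using congrFun h s)
      rcases hx.eq_or_block_concat hp (hge _ hv a (by simp)) hne with rfl | hb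
      · exact ⟨p, _, hp, rfl, .inr ⟨s, rfl⟩⟩
      · simpa using ih (p ++ [a]) hb (by simpa using hv)
  obtain _ | ⟨a, s⟩ := v
  · exact absurd rfl hne
  · obtain rfl : a = i := by
      by_contra h
      exact hv (congrFun (hx.pre_eq_zero a h) s)
    exact key s [a] (.inl ⟨a, le_rfl, (asc_self a).symm⟩) hv

theorem IsMaxOf.pre {p w : List (Fin (n+2))} (h : IsMaxOf x (p ++ w)) : IsMaxOf (pre p x) w := by
  refine ⟨h.1, fun v hv => ?_⟩
  rcases h.2 _ hv with h | h
  · exact .inl (List.append_cancel_left h)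
  · exact .inr (wlt_append_left.1 h)

theorem Block.exists_cons {p : List (Fin (n+2))} (h : Block i p) : ∃ t, p = i :: t := by
  have key : ∀ k, i ≤ k → ∃ t, asc n i k = i :: t := by
    intro k hk
    induction hk using ascending_induction with
    | base => exact ⟨[], asc_self i⟩
    | step k k' hk hkk ih => obtain ⟨t, ht⟩ := ih; exact ⟨t ++ [k'], by rw [asc_concat hk hkk, ht]; rfl⟩
  rcases h with ⟨k, hk, rfl⟩ | ⟨c, -, rfl⟩
  · exact key k hk
  · obtain ⟨t, ht⟩ := key _ (Fin.le_last i)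
    exact ⟨_, by rw [lynB, ht, List.cons_append]⟩

theorem IsMaxOf.lead {w : List (Fin (n+2))} (hx : x ∈ Usub n) (hge : ∀ v, x v ≠ 0 → ∀ b ∈ v, i ≤ b)
    (h : IsMaxOf x (i :: w)) : Lead i x := by
  refine ⟨hx, fun a ha => ?_⟩
  ext v
  by_contra hv
  have hia : i ≤ a := hge _ hv a (by simp)
  rcases h.2 _ hv with h | h
  · exact ha (List.cons_eq_cons.1 h).1
  · rcases wlt_cons.1 h with h | h
    · exact h.not_ge hia
    · exact ha h.1

/-- The largest word of an element factors into dominant Lyndon words. -/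
theorem IsMaxOf.exists_blocks {w : List (Fin (n+2))} (hx : x ∈ Usub n)
    (hge : ∀ v, x v ≠ 0 → ∀ b ∈ v, i ≤ b) (h : IsMaxOf x w) (hw : w = [] ∨ ∃ s, w = i :: s) :
    ∃ l : List (List (Fin (n+2))), (∀ p ∈ l, Block i p) ∧ w = l.flatten := by
  induction hd : w.length using Nat.strong_induction_on generalizing w x with
  | _ d ih =>
    rcases hw with rfl | ⟨s, rfl⟩
    · exact ⟨[], by simp, rfl⟩
    obtain ⟨p, t, hp, heq, ht⟩ := (h.lead hx hge).exists_block_prefix hge h.1 (by simp)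
    rw [heq] at h hd ⊢
    obtain ⟨q, rfl⟩ := hp.exists_cons
    obtain ⟨l, hl, rfl⟩ := ih t.length (by simp at hd; omega) (pre_mem _ hx)
      (fun v hv b hb => hge _ hv b (List.mem_append_right _ hb)) h.pre ht rfl
    exact ⟨_ :: l, by simpa using ⟨hp, hl⟩, rfl⟩

end Blocks

section Minimality

variable {n : ℕ} {i : Fin (n+2)} {x : G n}

theorem pre_comm_word {t : Fin (n+2)} {l : List (Fin (n+2))}
    (hl : ∀ a ∈ l, (a : ℕ) + 1 < t ∨ (t : ℕ) + 1 < a) (hx : x ∈ Usub n) :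
    pre [t] (pre l x) = pre l (pre [t] x) := by
  induction l generalizing x with
  | nil => rfl
  | cons a l ih =>
    rw [pre_cons a, ih (fun b hb => hl b (List.mem_cons_of_mem _ hb)) (pre_letter_mem a hx),
      ← pre_pair, pre_comm (hl a List.mem_cons_self) hx, pre_pair, ← pre_cons]

theorem Lead.pre_asc_pre_asc (hx : Lead i x) {k k' : Fin (n+2)} (hk : i ≤ k)
    (hkk : (k : ℕ) + 1 = k') :
    pre (asc n i k') (pre (asc n i k) x) = q2 • pre (asc n i k) (pre (asc n i k') x) := by
  induction hk using ascending_induction generalizing k' with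
  | base =>
    have hs := pre_serre (.inl hkk) (by omega) hx.mem
    have h0 := hx.pre_eq_zero k' (by rintro rfl; omega)
    rw [pre_cons k', h0, map_zero, add_zero, sub_eq_zero] at hs
    rw [asc_concat le_rfl hkk, asc_self, ← pre_append, ← pre_append]
    exact hs
  | step k l hk hkl ih =>
    have hy := pre_mem (asc n i k) hx.mem
    have hfar : ∀ a ∈ asc n i k, (a : ℕ) + 1 < k' ∨ (k' : ℕ) + 1 < a := by
      intro a ha
      rw [mem_asc] at ha
      omega
    have hs := pre_serre (.inl hkk) (by omega) (pre_mem (asc n i k) hy)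
    have h0 := hx.asc_vanish hk k' (by omega) (by omega) (by omega)
    have ih := ih hkl
    rw [pre_append] at h0
    simp only [asc_concat hk hkl, pre_append] at ih
    simp only [pre_cons k' (_ :: _), pre_cons l (_ :: _), ih, pre_comm_word hfar hy, h0, map_zero,
      map_smul, pre_comm_word hfar (pre_letter_mem l hy), add_zero] at hs
    rw [← smul_sub, smul_eq_zero, or_iff_right q2_ne_zero, sub_eq_zero] at hs
    simp only [asc_concat (hk.trans (Fin.le_def.2 (by omega))) hkk, asc_concat hk hkl, pre_append]
    exact hs

theorem asc_prefix {i k j : Fin (n+2)} (hk : i ≤ k) (hj : k ≤ j) :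
    ∃ r, asc n i j = asc n i k ++ r := by
  induction hj using ascending_induction with
  | base => exact ⟨[], by simp⟩
  | step j j' hj hjj ih =>
    obtain ⟨r, hr⟩ := ih
    exact ⟨r ++ [j'], by rw [asc_concat (hk.trans hj) hjj, hr, List.append_assoc]⟩

theorem exists_last {i j : Fin (n+2)} (hj : i ≤ j) {P : Fin (n+2) → Prop} (hi : P i)
    (h : ¬P j) : ∃ k k' : Fin (n+2), i ≤ k ∧ (k : ℕ) + 1 = k' ∧ k' ≤ j ∧ P k ∧ ¬P k' := by
  induction hj using ascending_induction with
  | base => exact absurd hi h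
  | step j j' hj hjj ih =>
    by_cases h' : P j
    · exact ⟨j, j', hj, hjj, le_rfl, h', h⟩
    · obtain ⟨k, k', h1, h2, h3, h4⟩ := ih h'
      exact ⟨k, k', h1, h2, by omega, h4⟩

theorem Lead.eq_zero_of_pre_asc (hx : Lead i x) (hge : ∀ v, x v ≠ 0 → ∀ b ∈ v, i ≤ b)
    {j : Fin (n+2)} (hj : i < j) (hmem : ∀ v, x v ≠ 0 → j ∈ v) {N : ℕ}
    (hN : ∀ v, x v ≠ 0 → v.length ≤ N) (h : pre (asc n i j) x = 0) : x = 0 := by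
  induction N using Nat.strong_induction_on generalizing x with
  | _ N ih =>
    by_contra hne
    obtain ⟨v, hv⟩ := Function.ne_iff.1 hne
    have hstart : pre (asc n i i) x ≠ 0 := by
      obtain _ | ⟨a, s⟩ := v
      · simpa using hmem _ hv
      obtain rfl : a = i := by
        by_contra ha
        exact hv (congrFun (hx.pre_eq_zero a ha) s)
      rw [asc_self]
      exact Function.ne_iff.2 ⟨s, hv⟩
    obtain ⟨k, k', hk, hkk, hkj, hy, hy'⟩ := exists_last hj.le (P := fun k => pre (asc n i k) x ≠ 0) hstart
      (not_not.2 h)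
    rw [not_not] at hy'
    have hj2 := j.2
    have hsup : ∀ v, pre (asc n i k) x v ≠ 0 → x (asc n i k ++ v) ≠ 0 := fun _ => id
    have hlen : 0 < (asc n i k).length :=
      List.length_pos_of_mem (mem_asc.2 ⟨le_rfl, hk⟩)
    have hlen' : ∀ v, pre (asc n i k) x v ≠ 0 → v.length + 1 ≤ N := fun v hv => by
      have := hN _ (hsup v hv)
      rw [List.length_append] at this
      omega
    obtain ⟨v', hv'⟩ := Function.ne_iff.1 hy
    have hN1 := hlen' _ hv'
    refine hy (ih (N - 1) (by omega) ⟨pre_mem _ hx.mem, fun a ha => ?_⟩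
      (fun v hv b hb => hge _ (hsup v hv) b (List.mem_append_right _ hb))
      (fun v hv => ?_) (fun v hv => by have := hlen' v hv; omega) ?_)
    · rw [← pre_append]
      rcases lt_or_gt_of_ne ha with h | h
      · ext v
        by_contra hv
        exact (hge (asc n i k ++ [a] ++ v) hv a (by simp)).not_gt h
      · by_cases hak : (a : ℕ) = k + 1
        · obtain rfl : a = k' := by omega
          rwa [← asc_concat hk hkk]
        · exact hx.asc_vanish hk a h hak (by omega)
    · refine (List.mem_append.1 (hmem _ (hsup v hv))).resolve_left fun h => ?_
      rw [mem_asc] at h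
      omega
    · obtain ⟨r, hr⟩ := asc_prefix (k := k') (by omega : i ≤ k') hkj
      rw [hr, pre_append, hx.pre_asc_pre_asc hk hkk, hy', map_zero, smul_zero, map_zero]

theorem le_max_of_asc {i j : Fin (n+2)} (hij : i ≤ j) (m : ℕ) {w : List (Fin (n+2))}
    (hx : x ∈ Usub n) (hmax : IsMaxOf x w)
    (hom : ∀ v, x v ≠ 0 → v.Perm (List.replicate m (asc n i j)).flatten) :
    w = (List.replicate m (asc n i j)).flatten ∨ wlt n (List.replicate m (asc n i j)).flatten w := by
  induction m generalizing x w with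
  | zero => exact .inl (hom w hmax.1).eq_nil
  | succ m ih =>
    have hge : ∀ v, x v ≠ 0 → ∀ b ∈ v, i ≤ b := fun v hv b hb => by
      have := (hom v hv).mem_iff.1 hb
      simp only [List.mem_flatten, List.mem_replicate] at this
      obtain ⟨_, ⟨-, rfl⟩, h⟩ := this
      exact (mem_asc.1 h).1
    rw [List.replicate_succ, List.flatten_cons] at hom ⊢
    obtain ⟨t, ht⟩ : ∃ t, asc n i j = i :: t := Block.exists_cons (.inl ⟨j, hij, rfl⟩)
    obtain _ | ⟨e, s⟩ := w
    · have := (hom _ hmax.1).length_eq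
      simp [ht] at this
    rcases (hge _ hmax.1 e (by simp)).lt_or_eq with he | rfl
    · right
      rw [ht]
      exact wlt_cons.2 (.inl he)
    have hlead := hmax.lead hx hge
    have hne : pre (asc n i j) x ≠ 0 := by
      intro h0
      rcases hij.lt_or_eq with hij | rfl
      · refine hmax.1 (congrFun (hlead.eq_zero_of_pre_asc hge hij (fun v hv => ?_)
          (fun v hv => (hom v hv).length_eq.le) h0) _)
        exact (hom v hv).mem_iff.2 (List.mem_append_left _ (mem_asc.2 ⟨hij.le, le_rfl⟩))
      · rw [asc_self] at h0
        exact hmax.1 (congrFun h0 s)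
    obtain ⟨v, hv⟩ := Function.ne_iff.1 hne
    rcases exists_prefix_or_lt_or_gt (i :: s) (asc n i j) with ⟨w', hw'⟩ | h | ⟨l, e, r, c, u', h1, h2, h3⟩
    · rw [hw'] at hmax ⊢
      rcases ih (pre_mem _ hx) hmax.pre (fun v hv => (List.perm_append_left_iff _).1 (hom _ hv))
        with h | h
      · exact .inl (by rw [h])
      · exact .inr (wlt_append_left.2 h)
    · rcases hmax.2 _ hv with h' | h'
      · have := h v
        rw [show asc n i j ++ v = i :: s from h'] at this
        exact absurd this (wlt_asymm this)
      · exact absurd (h v) (wlt_asymm h')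
    · right
      rw [h1, h2, List.append_assoc]
      exact wlt_append_left.2 (wlt_cons.2 (.inl h3))

theorem count_asc {i j : Fin (n+2)} (a : Fin (n+2)) :
    (asc n i j).count a = if i ≤ a ∧ a ≤ j then 1 else 0 := by
  split_ifs with h
  · exact List.count_eq_one_of_mem ((asc_sorted i j).imp ne_of_lt) (mem_asc.2 h)
  · exact List.count_eq_zero_of_not_mem (mt mem_asc.1 h)

theorem count_lynB {i j : Fin (n+2)} (a : Fin (n+2)) :
    (lynB n i j).count a = (if i ≤ a then 1 else 0) + if j ≤ a then 1 else 0 := by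
  simp [lynB, count_asc, Fin.le_last]

theorem count_flatten_replicate (a : Fin (n+2)) (m : ℕ) (u : List (Fin (n+2))) :
    (List.replicate m u).flatten.count a = m * u.count a := by
  simp [List.count_flatten]

theorem forall_eq_of_sum_eq {α : Type*} {l : List α} {f : α → ℕ} {c : ℕ}
    (h : (l.map f).sum = l.length * c) (hf : (∀ p ∈ l, f p ≤ c) ∨ ∀ p ∈ l, c ≤ f p) :
    ∀ p ∈ l, f p = c := by
  have h1 : (l.map fun _ => c).sum = l.length * c := by simp
  intro p hp
  by_contra hne
  rcases hf with hf | hf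
  · exact (List.sum_lt_sum f (fun _ => c) hf ⟨p, hp, lt_of_le_of_ne (hf p hp) hne⟩).ne (h.trans h1.symm)
  · exact (List.sum_lt_sum (fun _ => c) f hf ⟨p, hp, lt_of_le_of_ne (hf p hp) (Ne.symm hne)⟩).ne
      (h1.trans h.symm)

theorem le_max_of_lynB {i j : Fin (n+2)} (hij : i < j) (m : ℕ) {w : List (Fin (n+2))}
    (hx : x ∈ Usub n) (hmax : IsMaxOf x w)
    (hom : ∀ v, x v ≠ 0 → v.Perm (List.replicate m (lynB n i j)).flatten) :
    w = (List.replicate m (lynB n i j)).flatten ∨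
      wlt n (List.replicate m (lynB n i j)).flatten w := by
  have hge : ∀ v, x v ≠ 0 → ∀ b ∈ v, i ≤ b := fun v hv b hb => by
    have := (hom v hv).mem_iff.1 hb
    simp only [List.mem_flatten, List.mem_replicate, lynB] at this
    obtain ⟨_, ⟨-, rfl⟩, h⟩ := this
    simp only [List.mem_append, List.mem_reverse, mem_asc] at h
    omega
  have hw := hom w hmax.1
  have hblocks : w = [] ∨ (∃ s, w = i :: s) ∨ wlt n (List.replicate m (lynB n i j)).flatten w := by
    obtain _ | ⟨e, s⟩ := w
    · exact .inl rfl
    rcases (hge _ hmax.1 e (by simp)).lt_or_eq with he | rfl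
    · obtain _ | m := m
      · exact absurd hw.eq_nil (by simp)
      obtain ⟨t, ht⟩ : ∃ t, lynB n i j = i :: t := Block.exists_cons (.inr ⟨j, hij, rfl⟩)
      rw [List.replicate_succ, List.flatten_cons, ht]
      exact .inr (.inr (wlt_cons.2 (.inl he)))
    · exact .inr (.inl ⟨s, rfl⟩)
  rw [← or_assoc] at hblocks
  rcases hblocks with h | h
  · left
    obtain ⟨l, hl, rfl⟩ := hmax.exists_blocks hx hge h
    have hcount (a) : (l.map (List.count a)).sum = m * (lynB n i j).count a := by
      rw [← List.count_flatten, hw.count_eq, count_flatten_replicate]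
    have hm : l.length = m := by
      have := hcount i
      rw [List.map_congr_left (g := fun _ => 1)] at this
      · simpa [count_lynB, hij.not_ge] using this
      · rintro p hp
        rcases hl p hp with ⟨k, hk, rfl⟩ | ⟨c, hc, rfl⟩
        · simp [count_asc, hk]
        · simp [count_lynB, hc.not_ge]
    subst hm
    have h2 := forall_eq_of_sum_eq (hcount j) (.inl fun p hp => by
      rcases hl p hp with ⟨k, hk, rfl⟩ | ⟨c, hc, rfl⟩
      · rw [count_asc, count_lynB, if_pos hij.le, if_pos le_rfl]; split_ifs <;> omega
      · rw [count_lynB, count_lynB, if_pos hij.le, if_pos le_rfl]; split_ifs <;> omega)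
    have hform : ∀ p ∈ l, ∃ c, i < c ∧ c ≤ j ∧ p = lynB n i c := by
      intro p hp
      have h2 := h2 p hp
      rw [count_lynB, if_pos hij.le, if_pos le_rfl] at h2
      rcases hl p hp with ⟨k, hk, rfl⟩ | ⟨c, hc, rfl⟩
      · rw [count_asc] at h2; split_ifs at h2; omega
      · rw [count_lynB] at h2
        refine ⟨c, hc, ?_, rfl⟩
        by_contra hcj
        rw [if_neg hcj] at h2; split_ifs at h2 <;> omega
    have hj := j.2
    have hij' : (i : ℕ) < j := hij
    obtain ⟨j', hj'⟩ : ∃ j' : Fin (n+2), (j' : ℕ) + 1 = j := ⟨⟨j - 1, by omega⟩, by simp only; omega⟩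
    have h1 := forall_eq_of_sum_eq (hcount j') (.inr fun p hp => by
      obtain ⟨c, hc, hcj, rfl⟩ := hform p hp
      rw [count_lynB, count_lynB, if_pos (by omega : i ≤ j'), if_neg (by omega : ¬ j ≤ j')]
      omega)
    congr 1
    refine List.eq_replicate_iff.2 ⟨rfl, fun p hp => ?_⟩
    have h1 := h1 p hp
    obtain ⟨c, hc, hcj, rfl⟩ := hform p hp
    rw [count_lynB, count_lynB, if_pos (by omega : i ≤ j'), if_neg (by omega : ¬ j ≤ j')] at h1
    obtain rfl : c = j := by
      by_contra hne
      rw [if_pos (by omega : c ≤ j')] at h1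
      omega
    rfl
  · exact .inr h

end Minimality

section RootVectors

variable {n : ℕ} {i : Fin (n+2)}

theorem sh_del_concat {t : Fin (n+2)} {v : List (Fin (n+2))} (h : v.getLast? ≠ some t) :
    sh (del v) (del [t]) (v ++ [t]) = kap t v ∧ sh (del [t]) (del v) (v ++ [t]) = 1 := by
  induction v with
  | nil => simp [del_nil_sh, sh_del_nil, del_self, kap_nil]
  | cons a v ih =>
    have hne : v ++ [t] ≠ a :: v := fun h' => h (by rw [← h']; simp)
    have hv : v.getLast? ≠ some t := by
      intro h'
      apply h
      rw [List.getLast?_cons, h']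
      rfl
    obtain ⟨h1, h2⟩ := ih hv
    simp only [List.cons_append, sh_cons, pre_del_self, tw_del, pre_del_cons a t]
    constructor
    · split_ifs
      · simp [h1, kap_cons, kap_nil, sh_del_nil, del_ne hne, ff_comm a t]
      · simp [h1, kap_cons, kap_nil, ff_comm a t]
    · split_ifs
      · simp [h2, del_nil_sh, del_ne hne]
      · simp [h2]

theorem sh_del_append {t : Fin (n+2)} {l : List (Fin (n+2))} (h : t ∉ l) (v w : List (Fin (n+2))) :
    sh (del (l ++ v)) (del [t]) (l ++ w) = kap t l * sh (del v) (del [t]) w ∧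
      sh (del [t]) (del (l ++ v)) (l ++ w) = sh (del [t]) (del v) w := by
  induction l with
  | nil => simp [kap_nil]
  | cons a l ih =>
    rw [List.mem_cons, not_or] at h
    obtain ⟨h1, h2⟩ := ih h.2
    simp only [List.cons_append, sh_cons, pre_del_self, tw_del, pre_del_ne (Ne.symm h.1)]
    constructor
    · simp [h1, kap_cons, kap_nil, ff_comm a t, mul_assoc]
    · simp [h2]

theorem Block.eq_of_perm {p p' : List (Fin (n+2))} (h : Block i p) (h' : Block i p')
    (hp : p.Perm p') : p = p' := by
  rcases h with ⟨k, hk, rfl⟩ | ⟨c, hc, rfl⟩ <;> rcases h' with ⟨k', hk', rfl⟩ | ⟨c', hc', rfl⟩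
  · have h1 := (mem_asc.1 (hp.mem_iff.1 (mem_asc.2 ⟨hk, le_rfl⟩))).2
    have h2 := (mem_asc.1 (hp.mem_iff.2 (mem_asc.2 ⟨hk', le_rfl⟩))).2
    rw [le_antisymm h1 h2]
  · have := hp.count_eq (Fin.last (n+1))
    rw [count_asc, count_lynB, if_pos (Fin.le_last _), if_pos (Fin.le_last _)] at this
    split_ifs at this; omega
  · have := hp.count_eq (Fin.last (n+1))
    rw [count_asc, count_lynB, if_pos (Fin.le_last _), if_pos (Fin.le_last _)] at this
    split_ifs at this; omega
  · have h1 := hp.count_eq c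
    have h2 := hp.count_eq c'
    rw [count_lynB, count_lynB, if_pos hc.le, if_pos le_rfl] at h1
    rw [count_lynB, count_lynB, if_pos hc'.le, if_pos le_rfl] at h2
    have h3 : c' ≤ c := by by_contra h; rw [if_neg h] at h1; omega
    have h4 : c ≤ c' := by by_contra h; rw [if_neg h] at h2; omega
    rw [le_antisymm h4 h3]

theorem Block.le_of_mem {p : List (Fin (n+2))} (h : Block i p) {a : Fin (n+2)} (ha : a ∈ p) :
    i ≤ a := by
  rcases h with ⟨k, -, rfl⟩ | ⟨c, hc, rfl⟩
  · exact (mem_asc.1 ha).1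
  · simp only [lynB, List.mem_append, List.mem_reverse, mem_asc] at ha
    omega

theorem Block.count_self {p : List (Fin (n+2))} (h : Block i p) : p.count i = 1 := by
  rcases h with ⟨k, hk, rfl⟩ | ⟨c, hc, rfl⟩
  · simp [count_asc, hk]
  · simp [count_lynB, hc.not_ge]

/-- An element with leading letter `i` whose words are rearrangements of a dominant Lyndon word
`u` starting with `i` is a multiple of `u`. -/
theorem Lead.eq_smul_del {z : G n} (hz : Lead i z) {u : List (Fin (n+2))} (hu : Block i u)
    (hom : ∀ v, z v ≠ 0 → v.Perm u) : z = z u • del u := by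
  ext v
  by_cases hv : z v = 0
  · by_cases hvu : v = u
    · rw [hvu, Pi.smul_apply, del_self, smul_eq_mul, mul_one]
    · rw [hv, Pi.smul_apply, del_ne hvu, smul_zero]
  obtain ⟨t, rfl⟩ := hu.exists_cons
  have hne : v ≠ [] := by rintro rfl; simpa using hom _ hv
  obtain ⟨p, s, hp, rfl, hs⟩ := hz.exists_block_prefix
    (fun v hv b hb => hu.le_of_mem ((hom v hv).mem_iff.1 hb)) hv hne
  have hcount := (hom _ hv).count_eq i
  rw [List.count_append, hp.count_self, hu.count_self, Nat.add_eq_left] at hcount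
  obtain rfl : s = [] := hs.resolve_right (by rintro ⟨t, rfl⟩; simp at hcount)
  rw [List.append_nil] at hv ⊢
  have := hp.eq_of_perm hu (by simpa using hom _ hv)
  rw [this, Pi.smul_apply, del_self, smul_eq_mul, mul_one]

/-- The root vector of `v ++ [t]` is a `q`-commutator of the root vector of `v` with `t`. -/
theorem del_concat_mem {v : List (Fin (n+2))} {t : Fin (n+2)} (hv : Block i v)
    (hvt : Block i (v ++ [t])) (hmem : del v ∈ Usub n)
    (hne : sh (del v) (del [t]) (v ++ [t]) - (kap t v)⁻¹ * sh (del [t]) (del v) (v ++ [t]) ≠ 0) :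
    del (v ++ [t]) ∈ Usub n := by
  have ht : del [t] ∈ Usub n := by
    rw [← sh_del_nil (del [t])]
    exact letterProd_mem [t]
  set z : G n := sh (del v) (del [t]) - (kap t v)⁻¹ • sh (del [t]) (del v) with hz
  have hzmem : z ∈ Usub n := sub_mem (sh_mem hmem ht) (Submodule.smul_mem _ _ (sh_mem ht hmem))
  have hlead : Lead i z := by
    refine ⟨hzmem, fun a ha => ?_⟩
    obtain ⟨s, rfl⟩ := hv.exists_cons
    rw [hz, map_sub, map_smul, pre_sh, pre_letter_sh, pre_del_ne ha, pre_del_cons]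
    split_ifs with hat
    · simp [sh_del_nil, tw_del, smul_smul, inv_mul_cancel₀ (kap_ne_zero _ _)]
    · simp
  have hom : ∀ w, z w ≠ 0 → w.Perm (v ++ [t]) := by
    intro w hw
    by_cases h : sh (del v) (del [t]) w = 0
    · have h' : sh (del [t]) (del v) w ≠ 0 := fun h' => hw (by simp [hz, h, h'])
      obtain ⟨a, b, ha, hb, hp⟩ := exists_perm_of_sh_ne_zero h'
      rw [not_imp_comm.1 del_ne ha, not_imp_comm.1 del_ne hb] at hp
      exact hp.trans List.perm_append_comm
    · obtain ⟨a, b, ha, hb, hp⟩ := exists_perm_of_sh_ne_zero h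
      rwa [not_imp_comm.1 del_ne ha, not_imp_comm.1 del_ne hb] at hp
  have heq := hlead.eq_smul_del hvt hom
  have hne' : z (v ++ [t]) ≠ 0 := hne
  rw [heq] at hzmem
  exact (Submodule.smul_mem_iff _ hne').1 hzmem

theorem kap_far {t : Fin (n+2)} {l : List (Fin (n+2))}
    (h : ∀ a ∈ l, (t : ℕ) + 1 < a ∨ (a : ℕ) + 1 < t) : kap t l = 1 := by
  induction l with
  | nil => rfl
  | cons a l ih =>
    rw [kap_cons, ff_far (h a List.mem_cons_self), ih fun b hb => h b (List.mem_cons_of_mem _ hb),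
      one_mul]

theorem kap_asc_right {k t : Fin (n+2)} (hk : i ≤ k) (hkt : (k : ℕ) + 1 = t) :
    kap t (asc n i k) = qX ^ 2 := by
  induction hk using ascending_induction with
  | base => rw [asc_self, kap_cons, kap_nil, mul_one, ff_adj (.inr hkt)]
  | step k k' hk hkk ih =>
    rw [asc_concat hk hkk, kap_append, kap_cons, kap_nil, mul_one, ff_adj (.inr hkt), kap_far, one_mul]
    intro a ha
    rw [mem_asc] at ha
    omega

theorem kap_asc_left {t k j : Fin (n+2)} (hk : k ≤ j) (htk : (t : ℕ) + 1 = k) :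
    kap t (asc n k j) = qX ^ 2 := by
  induction hk using ascending_induction with
  | base => rw [asc_self, kap_cons, kap_nil, mul_one, ff_adj (.inl htk)]
  | step j j' hj hjj ih =>
    rw [asc_concat hj hjj, kap_append, ih, kap_cons, kap_nil, mul_one, ff_far (by omega), mul_one]

theorem asc_append {k k' j : Fin (n+2)} (hk : i ≤ k) (hkk : (k : ℕ) + 1 = k') (hj : k' ≤ j) :
    asc n i j = asc n i k ++ asc n k' j := by
  induction hj using ascending_induction with
  | base => rw [asc_self, asc_concat hk hkk]
  | step j j' hj hjj ih =>
    rw [asc_concat hj hjj, asc_concat (by omega) hjj, ih, List.append_assoc]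

theorem qX_sq_sub_ne_zero : qX ^ 2 - qX⁻¹ ^ 2 ≠ 0 := by
  intro h
  have h0 := qX_ne_zero
  field_simp at h
  refine qX_pow_ne_one (k := 4) (by norm_num) ?_
  linear_combination h

theorem qX_mul_inv_sq : qX ^ 2 * qX⁻¹ ^ 2 = 1 := by
  rw [← mul_pow, mul_inv_cancel₀ qX_ne_zero, one_pow]

theorem kap_lynB {c c' : Fin (n+2)} (hc : i < c) (hcc : (c : ℕ) + 1 = c') :
    kap c (lynB n i c') = qX ^ 2 := by
  have hc' : (i : ℕ) < c := hc
  have hlt := c'.2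
  obtain ⟨k, hk⟩ : ∃ k : Fin (n+2), (k : ℕ) + 1 = c := ⟨⟨c - 1, by omega⟩, by simp only; omega⟩
  have hik : i ≤ k := by omega
  rw [lynB, kap_append, kap_perm c (List.reverse_perm _), asc_append hik hk (Fin.le_last c),
    kap_append, kap_asc_right hik hk, asc_cons (Fin.le_last c') hcc, kap_cons,
    kap_asc_left (Fin.le_last c') hcc, ff_even (by omega)]
  linear_combination qX ^ 2 * (qX ^ 2 * qX⁻¹ ^ 2 + 1) * qX_mul_inv_sq

theorem kap_last_asc (hi : i < Fin.last (n+1)) :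
    kap (Fin.last (n+1)) (asc n i (Fin.last (n+1))) = -1 := by
  have hi' : (i : ℕ) < n + 1 := hi
  have hM : i ≤ (⟨n, by omega⟩ : Fin (n+2)) := Fin.le_def.2 (Nat.lt_succ_iff.1 hi')
  have hML : ((⟨n, by omega⟩ : Fin (n+2)) : ℕ) + 1 = Fin.last (n+1) := rfl
  rw [asc_concat hM hML, kap_append, kap_asc_right hM hML, kap_cons, kap_nil, ff_odd rfl]
  linear_combination - qX_mul_inv_sq

theorem del_asc_mem {k : Fin (n+2)} (hk : i ≤ k) : del (asc n i k) ∈ Usub n := by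
  induction hk using ascending_induction with
  | base =>
    rw [asc_self, ← sh_del_nil (del [i])]
    exact letterProd_mem [i]
  | step k k' hk hkk ih =>
    have h := asc_concat hk hkk
    rw [h]
    refine del_concat_mem (.inl ⟨k, hk, rfl⟩) (.inl ⟨k', by omega, h.symm⟩) ih ?_
    have hlast : (asc n i k).getLast? ≠ some k' := fun h' => by
      have := (mem_asc.1 (List.mem_of_getLast? h')).2
      omega
    obtain ⟨h1, h2⟩ := sh_del_concat hlast
    rw [h1, h2, kap_asc_right hk hkk, mul_one, ← inv_pow]
    exact qX_sq_sub_ne_zero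

theorem del_lynB_mem {c : Fin (n+2)} (hc : i < c) : del (lynB n i c) ∈ Usub n := by
  induction hc using descending_induction with
  | base hi =>
    rw [lynB_last]
    refine del_concat_mem (.inl ⟨_, hi.le, rfl⟩) (.inr ⟨_, hi, (lynB_last i).symm⟩)
      (del_asc_mem hi.le) ?_
    rw [kap_last_asc hi]
    have hi' : (i : ℕ) < n + 1 := hi
    have hM : i ≤ (⟨n, by omega⟩ : Fin (n+2)) := Fin.le_def.2 (Nat.lt_succ_iff.1 hi')
    have hML : ((⟨n, by omega⟩ : Fin (n+2)) : ℕ) + 1 = Fin.last (n+1) := rfl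
    have hnot : Fin.last (n+1) ∉ asc n i ⟨n, by omega⟩ := fun h => by
      have := Fin.le_def.1 (mem_asc.1 h).2
      simp at this
    obtain ⟨h1, h2⟩ := sh_del_append hnot [Fin.last (n+1)] [Fin.last (n+1), Fin.last (n+1)]
    have h3 : sh (del [Fin.last (n+1)]) (del [Fin.last (n+1)]) [Fin.last (n+1), Fin.last (n+1)]
        = 1 - qX⁻¹ ^ 2 := by
      simp [sh_cons, pre_del_self, tw_del, kap_cons, kap_nil, del_nil_sh, sh_del_nil, del_self,
        ff_odd]
      ring
    rw [asc_concat hM hML, List.append_assoc, List.singleton_append, h1, h2, h3,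
      kap_asc_right hM hML]
    convert qX_sq_sub_ne_zero using 1
    linear_combination - qX_mul_inv_sq
  | step c c' hc hcc ih =>
    have h := lynB_concat i hcc
    rw [h]
    refine del_concat_mem (.inr ⟨c', by omega, rfl⟩) (.inr ⟨c, hc, h.symm⟩) ih ?_
    have hlast : (lynB n i c').getLast? ≠ some c := by
      have hr : asc n c' (Fin.last (n+1)) ≠ [] := List.ne_nil_of_mem (mem_asc.2 ⟨le_rfl, Fin.le_last _⟩)
      rw [lynB, List.getLast?_append_of_ne_nil _ (by simpa using hr)]
      intro h'
      have := List.mem_of_getLast? h'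
      rw [List.mem_reverse, mem_asc] at this
      omega
    obtain ⟨h1, h2⟩ := sh_del_concat hlast
    rw [h1, h2, kap_lynB hc hcc, mul_one, ← inv_pow]
    exact qX_sq_sub_ne_zero

end RootVectors

section Powers

variable {n : ℕ} {i : Fin (n+2)}

/-- The product of all commutation factors between letters of `u`. -/
noncomputable def selfFactor (u : List (Fin (n+2))) : Kq := (u.map fun a => kap a u).prod

theorem prod_map_ff (u : List (Fin (n+2))) (t : Fin (n+2)) :
    (u.map fun a => ff a t).prod = kap t u := by
  simp only [kap, ff_comm _ t]

theorem selfFactor_concat (u : List (Fin (n+2))) (t : Fin (n+2)) :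
    selfFactor (u ++ [t]) = selfFactor u * kap t u ^ 2 * ff t t := by
  simp only [selfFactor, kap_append, kap_cons, kap_nil, mul_one, List.map_append,
    List.prod_append, List.prod_map_mul, prod_map_ff, List.map_cons, List.map_nil,
    List.prod_cons, List.prod_nil]
  ring

theorem selfFactor_asc {k : Fin (n+2)} (hk : i ≤ k) : selfFactor (asc n i k) = ff k k := by
  induction hk using ascending_induction with
  | base => simp [asc_self, selfFactor, kap_cons, kap_nil]
  | step k k' hk hkk ih =>
    have := k'.2
    rw [asc_concat hk hkk, selfFactor_concat, ih, kap_asc_right hk hkk, ff_even (by omega)]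
    linear_combination (qX ^ 2 * qX⁻¹ ^ 2 + 1) * ff k' k' * qX_mul_inv_sq

theorem selfFactor_lynB {c : Fin (n+2)} (hc : i < c) : selfFactor (lynB n i c) = qX⁻¹ ^ 4 := by
  induction hc using descending_induction with
  | base hi =>
    rw [lynB_last, selfFactor_concat, selfFactor_asc hi.le, kap_last_asc hi, ff_odd rfl]
    ring
  | step c c' hc hcc ih =>
    have := c'.2
    rw [lynB_concat i hcc, selfFactor_concat, ih, kap_lynB hc hcc, ff_even (by omega)]
    linear_combination (qX ^ 2 * qX⁻¹ ^ 2 + 1) * qX⁻¹ ^ 4 * qX_mul_inv_sq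

theorem Block.selfFactor_pow_ne_one {u : List (Fin (n+2))} (hu : Block i u) {m : ℕ} (hm : 0 < m) :
    selfFactor u ^ m ≠ 1 := by
  have h4 : selfFactor u = qX⁻¹ ^ 4 ∨ selfFactor u = -qX⁻¹ ^ 2 := by
    rcases hu with ⟨k, hk, rfl⟩ | ⟨c, hc, rfl⟩
    · rw [selfFactor_asc hk]
      by_cases h : (k : ℕ) = n + 1
      · exact .inr (ff_odd h)
      · exact .inl (ff_even (by omega))
    · exact .inl (selfFactor_lynB hc)
  have key {k : ℕ} (hk : 0 < k) : (qX⁻¹ ^ 4) ^ k ≠ 1 := by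
    rw [inv_pow, inv_pow, ← pow_mul]
    exact inv_ne_one.2 (qX_pow_ne_one (by omega))
  rcases h4 with h | h <;> rw [h]
  · exact key hm
  · intro h'
    refine key hm ?_
    rw [pow_mul qX⁻¹ 2 2, ← neg_sq, pow_right_comm, h', one_pow]

/-- The `m`-th shuffle power of the root vector of `u`. -/
noncomputable def shPow (u : List (Fin (n+2))) : ℕ → G n
  | 0 => del []
  | m + 1 => sh (del u) (shPow u m)

theorem shPow_mem {u : List (Fin (n+2))} (hu : del u ∈ Usub n) (m : ℕ) : shPow u m ∈ Usub n := by
  induction m with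
  | zero => exact letterProd_mem []
  | succ m ih => exact sh_mem hu ih

theorem perm_of_shPow_ne_zero (u : List (Fin (n+2))) {m : ℕ} {w : List (Fin (n+2))}
    (h : shPow u m w ≠ 0) : w.Perm (List.replicate m u).flatten := by
  induction m generalizing w with
  | zero => rw [not_imp_comm.1 del_ne h]; simp
  | succ m ih =>
    obtain ⟨v, v', hv, hv', hp⟩ := exists_perm_of_sh_ne_zero h
    rw [not_imp_comm.1 del_ne hv] at hp
    exact hp.trans ((ih hv').append_left u)

theorem pre_shPow_letter {u : List (Fin (n+2))} {a i : Fin (n+2)} (ha : a ≠ i) (m : ℕ) :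
    pre [a] (shPow (i :: u) m) = 0 := by
  induction m with
  | zero => exact pre_del_nil a
  | succ m ih => rw [shPow, pre_sh, pre_del_ne ha, ih]; simp

theorem pre_sh_left {l : List (Fin (n+2))} {g y : G n} {c : Fin (n+2) → Kq}
    (h : ∀ a ∈ l, pre [a] y = 0) (hc : ∀ a, tw a y = c a • y) :
    pre l (sh g y) = (l.map c).prod • sh (pre l g) y := by
  induction l generalizing g with
  | nil => simp
  | cons a l ih =>
    rw [pre_cons, pre_sh, h a List.mem_cons_self, hc, map_zero, add_zero, map_smul, map_smul,
      ih fun b hb => h b (List.mem_cons_of_mem _ hb), ← pre_cons, smul_smul, List.map_cons,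
      List.prod_cons]

theorem pre_sh_right {l : List (Fin (n+2))} {g y : G n} (h : ∀ a ∈ l, pre [a] g = 0) :
    pre l (sh g y) = sh g (pre l y) := by
  induction l generalizing y with
  | nil => rfl
  | cons a l ih =>
    rw [pre_cons, pre_sh, h a List.mem_cons_self, map_zero, LinearMap.zero_apply, zero_add,
      ih fun b hb => h b (List.mem_cons_of_mem _ hb), ← pre_cons]

theorem pre_shPow_succ {u l : List (Fin (n+2))} (hl : i ∉ l) (m : ℕ) :
    pre (i :: l) (shPow (i :: u) (m + 1)) =
      ((i :: l).map fun a => kap a (List.replicate m (i :: u)).flatten).prod •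
        sh (pre l (del u)) (shPow (i :: u) m) + sh (del (i :: u)) (pre (i :: l) (shPow (i :: u) m)) := by
  have hne : ∀ a ∈ l, a ≠ i := by rintro a ha rfl; exact hl ha
  have htw (a) : tw a (shPow (i :: u) m) = kap a (List.replicate m (i :: u)).flatten • shPow (i :: u) m :=
    tw_eq_smul fun _ => perm_of_shPow_ne_zero _
  rw [pre_cons, shPow, pre_sh, pre_del_self, map_add, htw, map_smul, map_smul,
    pre_sh_left (fun a ha => pre_shPow_letter (hne a ha) m) htw,
    pre_sh_right (fun a ha => pre_del_ne (hne a ha) u), ← pre_cons, smul_smul, List.map_cons,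
    List.prod_cons]

theorem pre_shPow_eq_zero {u l : List (Fin (n+2))} (hl : i ∉ l) (hlu : ¬l <+: u) (m : ℕ) :
    pre (i :: l) (shPow (i :: u) m) = 0 := by
  induction m with
  | zero => rw [pre_cons, shPow, pre_del_nil, map_zero]
  | succ m ih =>
    have h0 : pre l (del u : G n) = 0 := by
      ext w
      exact del_ne fun h => hlu ⟨w, h⟩
    rw [pre_shPow_succ hl, ih, h0]
    simp

theorem kap_flatten_replicate (a : Fin (n+2)) (u : List (Fin (n+2))) (m : ℕ) :
    kap a (List.replicate m u).flatten = kap a u ^ m := by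
  induction m with
  | zero => rfl
  | succ m ih => rw [List.replicate_succ, List.flatten_cons, kap_append, ih, pow_succ']

theorem pre_self_shPow {u : List (Fin (n+2))} (hu : i ∉ u) (m : ℕ) :
    pre (i :: u) (shPow (i :: u) (m + 1)) =
      (∑ k ∈ Finset.range (m + 1), selfFactor (i :: u) ^ k) • shPow (i :: u) m := by
  have hdel : pre u (del u : G n) = del [] := by
    ext w
    simp [del]
  have hstep (m : ℕ) : pre (i :: u) (shPow (i :: u) (m + 1)) =
      selfFactor (i :: u) ^ m • shPow (i :: u) m +
        sh (del (i :: u)) (pre (i :: u) (shPow (i :: u) m)) := by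
    have hprod : ((i :: u).map fun a => kap a (List.replicate m (i :: u)).flatten).prod =
        selfFactor (i :: u) ^ m := by
      rw [selfFactor, ← powMonoidHom_apply, map_list_prod, List.map_map]
      simp only [kap_flatten_replicate]
      rfl
    rw [pre_shPow_succ hu, hprod, hdel, del_nil_sh]
  induction m with
  | zero => rw [hstep, pre_cons, shPow, pre_del_nil]; simp
  | succ m ih =>
    rw [hstep, ih, map_smul, Finset.sum_range_succ _ (m + 1), add_smul, add_comm]
    rfl

theorem isMaxOf_shPow {u : List (Fin (n+2))} (hu : Block i u) (m : ℕ) :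
    IsMaxOf (shPow u m) (List.replicate m u).flatten := by
  obtain ⟨u', rfl⟩ := hu.exists_cons
  have hi : i ∉ u' := List.count_eq_zero.1 (by simpa only [List.count_cons_self, Nat.add_eq_right] using hu.count_self)
  induction m with
  | zero => exact ⟨by simp [shPow, del_self], fun v hv => .inl (not_imp_comm.1 del_ne hv)⟩
  | succ m ih =>
    have hsum : ∑ k ∈ Finset.range (m + 1), selfFactor (i :: u') ^ k ≠ 0 := by
      intro h
      have := mul_geom_sum (selfFactor (i :: u')) (m + 1)
      rw [h, mul_zero] at this
      exact hu.selfFactor_pow_ne_one m.succ_pos (sub_eq_zero.1 this.symm)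
    have happ (v) : shPow (i :: u') (m + 1) (i :: u' ++ v) =
        (∑ k ∈ Finset.range (m + 1), selfFactor (i :: u') ^ k) * shPow (i :: u') m v :=
      congrFun (pre_self_shPow hi m) v
    rw [List.replicate_succ, List.flatten_cons]
    refine ⟨by rw [happ]; exact mul_ne_zero hsum ih.1, fun v hv => ?_⟩
    rcases exists_prefix_or_lt_or_gt v (i :: u') with ⟨s, rfl⟩ | h | ⟨l, e, r, c, s, rfl, h, hce⟩
    · rw [happ] at hv
      rcases ih.2 s (right_ne_zero_of_mul hv) with h | h
      · exact .inl (by rw [h])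
      · exact .inr (wlt_append_left.2 h)
    · exact .inr (h _)
    · refine absurd ?_ hv
      have hei : e ≠ i := by
        have := hu.le_of_mem (a := c) (by rw [h]; simp)
        omega
      obtain _ | ⟨a, l⟩ := l
      · exact congrFun (pre_shPow_letter hei (m + 1)) r
      · simp only [List.cons_append, List.cons.injEq] at h
        obtain ⟨rfl, rfl⟩ := h
        rw [List.mem_append, not_or] at hi
        have := pre_shPow_eq_zero (i := i) (l := l ++ [e]) (u := l ++ c :: s)
          (by simp [hi.1, hei.symm]) (by simp [hce.ne']) (m + 1)
        simpa using congrFun this r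


theorem flatten_replicate_le_max {u : List (Fin (n+2))} (hu : Block i u) (m : ℕ)
    {w : List (Fin (n+2))} (hw : IsDominant n w)
    (hwt : wt n w = wt n (List.replicate m u).flatten) :
    w = (List.replicate m u).flatten ∨ wlt n (List.replicate m u).flatten w := by
  obtain ⟨x, hx, hmax, hom⟩ := hw.exists_homogeneous
  have hperm : w.Perm (List.replicate m u).flatten := List.perm_iff_count.2 (congrFun hwt)
  rcases hu with ⟨k, hk, rfl⟩ | ⟨c, hc, rfl⟩
  · exact le_max_of_asc hk m hx hmax fun v hv => (hom v hv).trans hperm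
  · exact le_max_of_lynB hc m hx hmax fun v hv => (hom v hv).trans hperm

theorem isDominant_flatten_replicate {u : List (Fin (n+2))} (hu : Block i u) (m : ℕ) :
    IsDominant n (List.replicate m u).flatten := by
  refine isDominant_iff.2 ⟨_, shPow_mem ?_ m, isMaxOf_shPow hu m⟩
  rcases hu with ⟨k, hk, rfl⟩ | ⟨c, hc, rfl⟩
  · exact del_asc_mem hk
  · exact del_lynB_mem hc

end Powers

/-- Let `β ∈ Φ⁺` be a reduced positive root, i.e. let `u` be the
corresponding dominant Lyndon word `ι⁺(β)` (either `(i,…,j)` with `i ≤ j`, or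
`(i,…,n,n,…,j)` with `i < j`), and let `m > 0`.  Then the `m`-fold concatenation
`ι⁺(β)^m` is the lexicographically smallest dominant word of weight `mβ`. -/
theorem stmt8 (n m : ℕ) (hm : 0 < m) (u : List (Fin (n+2)))
    (hu : (∃ i j : Fin (n+2), i ≤ j ∧ u = lynA n i j) ∨
          (∃ i j : Fin (n+2), i < j ∧ u = lynB n i j)) :
    IsDominant n (List.replicate m u).flatten ∧
    ∀ w : List (Fin (n+2)), IsDominant n w →
      wt n w = wt n (List.replicate m u).flatten →
      w = (List.replicate m u).flatten ∨ wlt n (List.replicate m u).flatten w := by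
  have hb : ∃ i, Block i u := by
    rcases hu with ⟨i, j, hij, rfl⟩ | ⟨i, j, hij, rfl⟩
    · exact ⟨i, .inl ⟨j, hij, rfl⟩⟩
    · exact ⟨i, .inr ⟨j, hij, rfl⟩⟩
  obtain ⟨i, hb⟩ := hb
  exact ⟨isDominant_flatten_replicate hb m, fun w => flatten_replicate_le_max hb m⟩

end SpinQHA
end

section
/- Let w, w′, ℓ, g be words with |w| = |ℓ|, |w′| = |g|, w ⪯ ℓ, and w′ ⪯ g. Then max(w ⋄ w′) ⪯ max(ℓ ⋄ g). Moreover, if w ≺ ℓ or w′ ≺ g, then max(w ⋄ w′) ≺ max(ℓ ⋄ g). -/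
namespace SpinQHA

/-- `IsShuffle x y z`: the word `z` is an interleaving of `x` and `y`. -/
inductive IsShuffle {α : Type*} : List α → List α → List α → Prop
  | nil_left (y : List α) : IsShuffle [] y y
  | nil_right (x : List α) : IsShuffle x [] x
  | cons_left {x y z : List α} (i : α) : IsShuffle x y z → IsShuffle (i :: x) y (i :: z)
  | cons_right {x y z : List α} (j : α) : IsShuffle x y z → IsShuffle x (j :: y) (j :: z)

theorem IsShuffle.perm {α : Type*} {x y z : List α} (h : IsShuffle x y z) : z.Perm (x ++ y) := by
  induction h with
  | nil_left y => simp
  | nil_right x => simp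
  | cons_left i _ ih => simpa using ih
  | cons_right j _ ih => exact (ih.cons j).trans List.perm_middle.symm

theorem isShuffle_nil_left_iff {α : Type*} {y z : List α} : IsShuffle [] y z ↔ z = y := by
  refine ⟨fun h => ?_, fun h => h ▸ .nil_left y⟩
  generalize hx : ([] : List α) = x at h
  induction h with
  | nil_left y => rfl
  | nil_right x => exact hx.symm
  | cons_left i _ ih => cases hx
  | cons_right j _ ih => rw [ih hx]

theorem isShuffle_nil_right_iff {α : Type*} {x z : List α} : IsShuffle x [] z ↔ z = x := by
  refine ⟨fun h => ?_, fun h => h ▸ .nil_right x⟩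
  generalize hy : ([] : List α) = y at h
  induction h with
  | nil_left y => exact hy.symm
  | nil_right x => rfl
  | cons_left i _ ih => rw [ih hy]
  | cons_right j _ ih => cases hy

theorem isShuffle_cons_cons_iff {α : Type*} {i j : α} {x y z : List α} :
    IsShuffle (i :: x) (j :: y) z ↔
      (∃ z', z = i :: z' ∧ IsShuffle x (j :: y) z') ∨
        ∃ z', z = j :: z' ∧ IsShuffle (i :: x) y z' := by
  constructor
  · intro h
    cases h with
    | cons_left _ h => exact .inl ⟨_, rfl, h⟩
    | cons_right _ h => exact .inr ⟨_, rfl, h⟩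
  · rintro (⟨z', rfl, h⟩ | ⟨z', rfl, h⟩)
    · exact .cons_left i h
    · exact .cons_right j h

theorem lex_append_singleton_iff {α : Type*} {r : α → α → Prop} {a b : List α} {i j : α}
    (h : a.length = b.length) :
    List.Lex r (a ++ [i]) (b ++ [j]) ↔ List.Lex r a b ∨ (a = b ∧ r i j) := by
  induction a generalizing b with
  | nil =>
    obtain rfl : b = [] := List.length_eq_zero_iff.mp (by simpa using h.symm)
    simp [List.cons_lex_cons_iff]
  | cons c a ih =>
    cases b with
    | nil => simp at h
    | cons d b =>
      have := ih (b := b) (by simpa using h)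
      simp only [List.cons_append, List.cons_lex_cons_iff, this, List.cons.injEq]
      tauto

/-- Replacing the two factors of a shuffle by larger words of the same lengths
makes the shuffle larger, strictly so unless nothing changes. -/
theorem IsShuffle.exists_lex {α : Type*} {r : α → α → Prop} {x y z x' y' : List α}
    (hr : ∀ a, ¬ r a a) (h : IsShuffle x y z) (hx : x.length = x'.length) (hy : y.length = y'.length)
    (hxl : x = x' ∨ List.Lex r x.reverse x'.reverse)
    (hyl : y = y' ∨ List.Lex r y.reverse y'.reverse) :
    ∃ z', IsShuffle x' y' z' ∧
      ((x = x' ∧ y = y' ∧ z = z') ∨ List.Lex r z.reverse z'.reverse) := by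
  induction h generalizing x' y' with
  | nil_left y =>
    obtain rfl : x' = [] := List.length_eq_zero_iff.mp (by simpa using hx.symm)
    refine ⟨y', .nil_left y', ?_⟩
    tauto
  | nil_right x =>
    obtain rfl : y' = [] := List.length_eq_zero_iff.mp (by simpa using hy.symm)
    refine ⟨x', .nil_right x', ?_⟩
    tauto
  | @cons_left x y z i h ih =>
    cases x' with
    | nil => simp at hx
    | cons i' x' =>
      have hx' : x.length = x'.length := by simpa using hx
      rw [List.reverse_cons, List.reverse_cons, lex_append_singleton_iff (by simpa using hx'),
        List.reverse_inj] at hxl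
      obtain ⟨z', hz', hl⟩ := ih hx' hy (by grind) hyl
      have hlen : z.length = z'.length := by
        rw [h.perm.length_eq, hz'.perm.length_eq]; simp [hx', hy]
      refine ⟨i' :: z', .cons_left i' hz', ?_⟩
      rw [List.reverse_cons, List.reverse_cons, lex_append_singleton_iff (by simpa using hlen),
        List.reverse_inj]
      clear ih
      simp only [List.cons.injEq] at hxl ⊢
      have := List.lex_irrefl hr x.reverse
      grind
  | @cons_right x y z i h ih =>
    cases y' with
    | nil => simp at hy
    | cons i' y' =>
      have hy' : y.length = y'.length := by simpa using hy
      rw [List.reverse_cons, List.reverse_cons, lex_append_singleton_iff (by simpa using hy'),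
        List.reverse_inj] at hyl
      obtain ⟨z', hz', hl⟩ := ih hx hy' hxl (by grind)
      have hlen : z.length = z'.length := by
        rw [h.perm.length_eq, hz'.perm.length_eq]; simp [hx, hy']
      refine ⟨i' :: z', .cons_right i' hz', ?_⟩
      rw [List.reverse_cons, List.reverse_cons, lex_append_singleton_iff (by simpa using hlen),
        List.reverse_inj]
      clear ih
      simp only [List.cons.injEq] at hyl ⊢
      have := List.lex_irrefl hr y.reverse
      grind

/-- The element `-q²`. At `q² = -1` the super-signs are absorbed into the powers of `q`. -/
noncomputable def negSq : Kq := -qX ^ 2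

theorem negSq_ne_zero : negSq ≠ 0 := by
  simp [negSq, qX, RatFunc.X_ne_zero]

theorem transcendental_negSq : Transcendental ℚ negSq := by
  have h : Transcendental ℚ qX := by
    convert RatFunc.transcendental_X (K := ℚ) using 1
    · exact Subsingleton.elim _ _
    · rfl
  intro ha
  refine h.pow (n := 2) (by norm_num) ?_
  simpa [negSq] using ha.neg

/-- Laurent polynomials in `-q²` whose value at `-q² = 1` is positive. -/
def PosAtOne (f : Kq) : Prop :=
  ∃ (k : ℤ) (p : Polynomial ℚ), f = negSq ^ k * Polynomial.aeval negSq p ∧ 0 < p.eval 1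

theorem PosAtOne.ne_zero {f : Kq} (h : PosAtOne f) : f ≠ 0 := by
  obtain ⟨k, p, rfl, hp⟩ := h
  refine mul_ne_zero (zpow_ne_zero k negSq_ne_zero) fun h0 => ?_
  rw [(transcendental_iff.mp transcendental_negSq) p h0] at hp
  simp at hp

theorem posAtOne_one : PosAtOne 1 := ⟨0, 1, by simp, by simp⟩

theorem PosAtOne.zpow_mul {f : Kq} (h : PosAtOne f) (m : ℤ) : PosAtOne (negSq ^ m * f) := by
  obtain ⟨k, p, rfl, hp⟩ := h
  exact ⟨m + k, p, by rw [zpow_add₀ negSq_ne_zero, mul_assoc], hp⟩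

theorem PosAtOne.add {f g : Kq} (hf : PosAtOne f) (hg : PosAtOne g) : PosAtOne (f + g) := by
  obtain ⟨k, p, rfl, hp⟩ := hf
  obtain ⟨m, r, rfl, hr⟩ := hg
  have key : ∀ s t : ℤ, min s t ≤ s → negSq ^ s = negSq ^ min s t * negSq ^ (s - min s t).toNat :=
    fun s t h => by
      rw [← zpow_natCast, Int.toNat_of_nonneg (sub_nonneg.mpr h), ← zpow_add₀ negSq_ne_zero]
      congr 1; ring
  refine ⟨min k m, Polynomial.X ^ (k - min k m).toNat * p +
    Polynomial.X ^ (m - min k m).toNat * r, ?_, by simpa using add_pos hp hr⟩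
  rw [key k m (min_le_left _ _)]
  have := key m k (min_le_left _ _)
  rw [min_comm m k] at this
  rw [this]
  simp only [map_add, map_mul, map_pow, Polynomial.aeval_X]
  ring

/-- The sign attached to a letter `a` preceding `b`: `-1` exactly when `b` is the successor
of `a`. -/
def adjSign {n : ℕ} (a b : Fin (n + 2)) : ℤˣ := if (a : ℕ) + 1 = b then -1 else 1

/-- Product of the signs of the letter `i` against a word. -/
def letterSign {n : ℕ} (i : Fin (n + 2)) (x : List (Fin (n + 2))) : ℤˣ := (x.map (adjSign i)).prod

/-- Product of the signs of all pairs of letters of a word. -/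
def wordSign {n : ℕ} : List (Fin (n + 2)) → ℤˣ
  | [] => 1
  | i :: x => letterSign i x * wordSign x

/-- Product of the signs of the letters of a word against those of another word. -/
def pairSign {n : ℕ} (x y : List (Fin (n + 2))) : ℤˣ := (x.map (letterSign · y)).prod

/-- The common sign, at `q² = -1`, of all contributions of `x` and `y` to the coefficient
of `z`. -/
def shuffleSign {n : ℕ} (x y z : List (Fin (n + 2))) : ℤˣ :=
  wordSign z * wordSign x * wordSign y * pairSign x y

theorem letterSign_of_isShuffle {n : ℕ} {x y z : List (Fin (n + 2))} (h : IsShuffle x y z)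
    (i : Fin (n + 2)) : letterSign i z = letterSign i x * letterSign i y := by
  simp [letterSign, (h.perm.map (adjSign i)).prod_eq]

theorem pairSign_cons_right {n : ℕ} (x y : List (Fin (n + 2))) (j : Fin (n + 2)) :
    pairSign x (j :: y) = (x.map (adjSign · j)).prod * pairSign x y := by
  simp [pairSign, letterSign, List.prod_map_mul]

theorem shuffleSign_nil_left {n : ℕ} (y : List (Fin (n + 2))) : shuffleSign [] y y = 1 := by
  simp [shuffleSign, wordSign, pairSign]

theorem shuffleSign_nil_right {n : ℕ} (x : List (Fin (n + 2))) : shuffleSign x [] x = 1 := by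
  simp [shuffleSign, wordSign, pairSign, letterSign]

theorem shuffleSign_cons_left {n : ℕ} {x y z : List (Fin (n + 2))} (h : IsShuffle x y z)
    (i : Fin (n + 2)) : shuffleSign (i :: x) y (i :: z) = shuffleSign x y z := by
  have e1 := Int.units_mul_self (letterSign i x)
  have e2 := Int.units_mul_self (letterSign i y)
  have e3 : pairSign (i :: x) y = letterSign i y * pairSign x y := by simp [pairSign]
  simp only [shuffleSign, wordSign, letterSign_of_isShuffle h, e3]
  calc _ = (letterSign i x * letterSign i x) * (letterSign i y * letterSign i y) *
        (wordSign z * wordSign x * wordSign y * pairSign x y) := by ac_rfl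
    _ = _ := by rw [e1, e2]; simp

/-- The symmetrized sign of a word against a letter. -/
def crossSign {n : ℕ} (x : List (Fin (n + 2))) (j : Fin (n + 2)) : ℤˣ :=
  letterSign j x * (x.map (adjSign · j)).prod

theorem shuffleSign_cons_right {n : ℕ} {x y z : List (Fin (n + 2))} (h : IsShuffle x y z)
    (j : Fin (n + 2)) :
    shuffleSign x (j :: y) (j :: z) = crossSign x j * shuffleSign x y z := by
  have e2 := Int.units_mul_self (letterSign j y)
  simp only [shuffleSign, wordSign, letterSign_of_isShuffle h, pairSign_cons_right, crossSign]
  calc _ = (letterSign j y * letterSign j y) *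
        (letterSign j x * (x.map (adjSign · j)).prod *
          (wordSign z * wordSign x * wordSign y * pairSign x y)) := by ac_rfl
    _ = _ := by rw [e2, one_mul]

theorem crossSign_cons {n : ℕ} (a : Fin (n + 2)) (x : List (Fin (n + 2))) (j : Fin (n + 2)) :
    crossSign (a :: x) j = (adjSign j a * adjSign a j) * crossSign x j := by
  simp only [crossSign, letterSign, List.map_cons, List.prod_cons]
  ac_rfl

theorem bil_wt_nil (n : ℕ) (ν : Fin (n + 2) → ℕ) : bil n (wt n []) ν = 0 := by
  simp [bil, wt]

theorem bil_wt_cons_singleton (n : ℕ) (a j : Fin (n + 2)) (x : List (Fin (n + 2))) :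
    bil n (wt n (a :: x)) (wt n [j]) = cart n a j + bil n (wt n x) (wt n [j]) := by
  simp [bil, wt, List.count_cons, add_mul, Finset.sum_add_distrib, add_comm]

/-- The scalar picked up when the letter `j` passes the word `x`. -/
noncomputable def braiding (n : ℕ) (x : List (Fin (n + 2))) (j : Fin (n + 2)) : Kq :=
  (-1 : Kq) ^ (pw n x * pa n j) * qX ^ (-(bil n (wt n x) (wt n [j])))

theorem letter_braiding (n : ℕ) (a j : Fin (n + 2)) :
    ∃ m : ℤ, (-1 : Kq) ^ (pa n a * pa n j) * qX ^ (-cart n a j) =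
      ((adjSign j a * adjSign a j : ℤˣ) : ℤ) * negSq ^ m := by
  by_cases h : a = j
  · subst h
    by_cases ha : (a : ℕ) = n + 1
    · refine ⟨-1, ?_⟩
      simp [cart, pa, ha, adjSign, negSq, zpow_neg]
    · refine ⟨-2, ?_⟩
      simp [cart, pa, ha, adjSign, negSq, zpow_neg]
      ring
  · have hp : pa n a * pa n j = 0 := by
      have : (a : ℕ) ≠ j := fun e => h (Fin.ext e)
      unfold pa
      grind
    rw [hp]
    by_cases h1 : (a : ℕ) + 1 = j
    · have h2 : ¬ (j : ℕ) + 1 = a := by omega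
      refine ⟨1, ?_⟩
      simp [cart, h, h1, h2, adjSign, negSq]
    · by_cases h2 : (j : ℕ) + 1 = a
      · refine ⟨1, ?_⟩
        simp [cart, h, h1, h2, adjSign, negSq]
      · refine ⟨0, ?_⟩
        simp [cart, h, h1, h2, adjSign]

theorem braiding_eq (n : ℕ) (x : List (Fin (n + 2))) (j : Fin (n + 2)) :
    ∃ m : ℤ, braiding n x j = ((crossSign x j : ℤˣ) : ℤ) * negSq ^ m := by
  induction x with
  | nil => exact ⟨0, by simp [braiding, bil_wt_nil, pw, crossSign, letterSign]⟩
  | cons a x ih =>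
    obtain ⟨m, hm⟩ := ih
    obtain ⟨k, hk⟩ := letter_braiding n a j
    have hq : qX ≠ 0 := RatFunc.X_ne_zero
    refine ⟨k + m, ?_⟩
    calc braiding n (a :: x) j
        = ((-1 : Kq) ^ (pa n a * pa n j) * qX ^ (-cart n a j)) * braiding n x j := by
          simp only [braiding, bil_wt_cons_singleton, pw, List.map_cons, List.sum_cons, add_mul,
            pow_add, neg_add, zpow_add₀ hq]
          ring
      _ = _ := by
          rw [hk, hm, crossSign_cons, zpow_add₀ negSq_ne_zero]
          push_cast
          ring

theorem mapDomain_cons_apply {α R : Type*} [DecidableEq α] [AddCommMonoid R] (i k : α)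
    (f : List α →₀ R) (z : List α) :
    Finsupp.mapDomain (List.cons i) f (k :: z) = if k = i then f z else 0 := by
  split_ifs with h
  · subst h
    exact Finsupp.mapDomain_apply List.cons_injective f z
  · exact Finsupp.mapDomain_of_notMem_range f _ (by rintro ⟨y, hy⟩; simp at hy; exact h hy.1.symm)

theorem shAux_nil_right (n : ℕ) (x : List (Fin (n + 2))) :
    shAux n x [] = Finsupp.single x 1 := by
  cases x <;> simp [shAux]

theorem shAux_cons_cons_nil (n : ℕ) (i j : Fin (n + 2)) (x y : List (Fin (n + 2))) :
    shAux n (i :: x) (j :: y) [] = 0 := by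
  rw [shAux]
  simp [Finsupp.mapDomain_of_notMem_range]

theorem shAux_cons_cons_cons (n : ℕ) (i j k : Fin (n + 2)) (x y z : List (Fin (n + 2))) :
    shAux n (i :: x) (j :: y) (k :: z) = (if k = i then shAux n x (j :: y) z else 0) +
      braiding n (i :: x) j * (if k = j then shAux n (i :: x) y z else 0) := by
  rw [shAux]
  simp [mapDomain_cons_apply, braiding]

/-- A coefficient of a shuffle product vanishes off the interleavings, and at `q² = -1`
it is nonzero with sign `shuffleSign` on them. -/
theorem shAux_coeff (n : ℕ) (x y z : List (Fin (n + 2))) :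
    (IsShuffle x y z ∧ PosAtOne (((shuffleSign x y z : ℤˣ) : ℤ) * shAux n x y z)) ∨
      (¬ IsShuffle x y z ∧ shAux n x y z = 0) := by
  match x, y, z with
  | [], y, z =>
    rw [isShuffle_nil_left_iff]
    by_cases h : z = y
    · subst h
      exact .inl ⟨rfl, by simpa [shAux, shuffleSign_nil_left] using posAtOne_one⟩
    · exact .inr ⟨h, by simp [shAux, Ne.symm h]⟩
  | i :: x, [], z =>
    rw [isShuffle_nil_right_iff, shAux_nil_right]
    by_cases h : z = i :: x
    · subst h
      exact .inl ⟨rfl, by simpa [shuffleSign_nil_right] using posAtOne_one⟩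
    · exact .inr ⟨h, by simp [Ne.symm h]⟩
  | i :: x, j :: y, [] =>
    exact .inr ⟨by simp [isShuffle_cons_cons_iff], shAux_cons_cons_nil n i j x y⟩
  | i :: x, j :: y, k :: z =>
    rw [shAux_cons_cons_cons, isShuffle_cons_cons_iff]
    set U := if k = i then shAux n x (j :: y) z else 0 with hU
    set V := braiding n (i :: x) j * if k = j then shAux n (i :: x) y z else 0 with hV
    set S := shuffleSign (i :: x) (j :: y) (k :: z) with hS
    have h₁ : ((∃ z', k :: z = i :: z' ∧ IsShuffle x (j :: y) z') ∧
        PosAtOne (((S : ℤˣ) : ℤ) * U)) ∨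
        (¬ (∃ z', k :: z = i :: z' ∧ IsShuffle x (j :: y) z') ∧ U = 0) := by
      by_cases hk : k = i
      · subst hk
        rcases shAux_coeff n x (j :: y) z with ⟨h, hp⟩ | ⟨h, h0⟩
        · exact .inl ⟨⟨z, rfl, h⟩, by rw [hU, hS, shuffleSign_cons_left h]; simpa using hp⟩
        · exact .inr ⟨by simpa using h, by simpa [hU] using h0⟩
      · exact .inr ⟨by simp [hk], by simp [hU, hk]⟩
    have h₂ : ((∃ z', k :: z = j :: z' ∧ IsShuffle (i :: x) y z') ∧
        PosAtOne (((S : ℤˣ) : ℤ) * V)) ∨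
        (¬ (∃ z', k :: z = j :: z' ∧ IsShuffle (i :: x) y z') ∧ V = 0) := by
      by_cases hk : k = j
      · subst hk
        rcases shAux_coeff n (i :: x) y z with ⟨h, hp⟩ | ⟨h, h0⟩
        · refine .inl ⟨⟨z, rfl, h⟩, ?_⟩
          obtain ⟨m, hm⟩ := braiding_eq n (i :: x) k
          have hc : (((crossSign (i :: x) k : ℤˣ) : ℤ) : Kq) *
              (((crossSign (i :: x) k : ℤˣ) : ℤ) : Kq) = 1 := by
            rw [← Int.cast_mul, ← Units.val_mul, Int.units_mul_self]
            simp
          convert hp.zpow_mul m using 1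
          rw [hV, hS, shuffleSign_cons_right h, hm, if_pos rfl]
          push_cast
          linear_combination (((shuffleSign (i :: x) y z : ℤˣ) : ℤ) : Kq) * negSq ^ m *
            shAux n (i :: x) y z * hc
        · exact .inr ⟨by simpa using h, by simp [hV, h0]⟩
      · exact .inr ⟨by simp [hk], by simp [hV, hk]⟩
    rcases h₁ with ⟨a, hU'⟩ | ⟨a, hU'⟩ <;> rcases h₂ with ⟨b, hV'⟩ | ⟨b, hV'⟩
    · exact .inl ⟨.inl a, by rw [mul_add]; exact hU'.add hV'⟩
    · exact .inl ⟨.inl a, by rwa [hV', add_zero]⟩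
    · exact .inl ⟨.inr b, by rwa [hU', zero_add]⟩
    · exact .inr ⟨not_or.mpr ⟨a, b⟩, by rw [hU', hV', add_zero]⟩
  termination_by x.length + y.length

theorem mem_support_shw_iff (n : ℕ) (x y z : List (Fin (n + 2))) :
    z ∈ (shw n x y).support ↔ IsShuffle x.reverse y.reverse z.reverse := by
  have h : shw n x y z = shAux n x.reverse y.reverse z.reverse := by
    conv_lhs => rw [shw, ← List.reverse_reverse z]
    exact Finsupp.mapDomain_apply List.reverse_injective _ _
  rw [Finsupp.mem_support_iff, h]
  rcases shAux_coeff n x.reverse y.reverse z.reverse with ⟨h, hp⟩ | ⟨h, h0⟩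
  · exact iff_of_true (right_ne_zero_of_mul hp.ne_zero) h
  · exact iff_of_false (not_not.mpr h0) h

theorem length_eq_of_wt_eq {n : ℕ} {x y : List (Fin (n + 2))} (h : wt n x = wt n y) :
    x.length = y.length :=
  (List.perm_iff_count.mpr fun a => congrFun h a).length_eq

/-- Let `w, w', ℓ, g` be words with `|w| = |ℓ|`, `|w'| = |g|`,
`w ⪯ ℓ` and `w' ⪯ g`.  Then `max(w ⋄ w') ⪯ max(ℓ ⋄ g)`; moreover if `w ≺ ℓ` or
`w' ≺ g` then `max(w ⋄ w') ≺ max(ℓ ⋄ g)`. -/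
theorem stmt9 (n : ℕ) (w w' l g M1 M2 : List (Fin (n+2)))
    (hwl : wt n w = wt n l) (hw'g : wt n w' = wt n g)
    (h1 : w = l ∨ wlt n w l) (h2 : w' = g ∨ wlt n w' g)
    (hM1 : IsMaxWord n (shw n w w') M1) (hM2 : IsMaxWord n (shw n l g) M2) :
    (M1 = M2 ∨ wlt n M1 M2) ∧ ((wlt n w l ∨ wlt n w' g) → wlt n M1 M2) := by
  rw [IsMaxWord, mem_support_shw_iff] at hM1
  obtain ⟨z, hz, hlex⟩ := IsShuffle.exists_lex (r := (· < ·)) (x' := l.reverse)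
    (y' := g.reverse) lt_irrefl hM1.1 (by simpa using length_eq_of_wt_eq hwl) (by simpa using length_eq_of_wt_eq hw'g)
    (by simpa [wlt] using h1) (by simpa [wlt] using h2)
  have hz2 : z.reverse = M2 ∨ z.reverse < M2 :=
    hM2.2 z.reverse ((mem_support_shw_iff n l g z.reverse).mpr (by simpa using hz))
  have hle : z.reverse ≤ M2 := le_iff_eq_or_lt.mpr hz2
  change (M1 = M2 ∨ M1 < M2) ∧ (w < l ∨ w' < g → M1 < M2)
  rcases hlex with ⟨hw, hw', hzM⟩ | hlt
  · rw [List.reverse_inj] at hw hw'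
    subst hw hw' hzM
    refine ⟨le_iff_eq_or_lt.mp (by simpa using hle), fun h => ?_⟩
    rcases h with h | h <;> exact absurd h (lt_irrefl _)
  · have hlt' : M1 < z.reverse := by simpa using hlt
    exact ⟨.inr (hlt'.trans_le hle), fun _ => hlt'.trans_le hle⟩

end SpinQHA
end

section
/- Let 𝐢 be a Lyndon word, 𝐣 a dominant word with 𝐢 ≻ 𝐣, and m a positive integer. Then the coefficient of the concatenated word 𝐢^m𝐣 in the shuffle product 𝐣 ⋄ 𝐢^m is 1. -/
namespace SpinQHA

/-- The `m`-fold concatenation `w^m` of a word. -/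
def rep (n : ℕ) (m : ℕ) (w : List (Fin (n+2))) : List (Fin (n+2)) :=
  (List.replicate m w).flatten

section Shuffles

variable {α : Type*}

/-- The subword formed by the letters labelled `b`.  A word labelled by `Bool` records a
shuffle of its two labelled subwords. -/
def labelled (b : Bool) (L : List (Bool × α)) : List α := (L.filter (·.1 == b)).map Prod.snd

@[simp] lemma labelled_nil (b : Bool) : labelled b ([] : List (Bool × α)) = [] := rfl

@[simp] lemma labelled_append (b : Bool) (L M : List (Bool × α)) :
    labelled b (L ++ M) = labelled b L ++ labelled b M := by
  simp [labelled]

@[simp] lemma labelled_reverse (b : Bool) (L : List (Bool × α)) :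
    labelled b L.reverse = (labelled b L).reverse := by
  simp [labelled]

@[simp] lemma labelled_true_cons_true (a : α) (L : List (Bool × α)) :
    labelled true ((true, a) :: L) = a :: labelled true L := rfl

@[simp] lemma labelled_true_cons_false (a : α) (L : List (Bool × α)) :
    labelled true ((false, a) :: L) = labelled true L := rfl

@[simp] lemma labelled_false_cons_true (a : α) (L : List (Bool × α)) :
    labelled false ((true, a) :: L) = labelled false L := rfl

@[simp] lemma labelled_false_cons_false (a : α) (L : List (Bool × α)) :
    labelled false ((false, a) :: L) = a :: labelled false L := rfl

@[simp] lemma labelled_map (b c : Bool) (x : List α) :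
    labelled b (x.map (Prod.mk c)) = if c = b then x else [] := by
  induction x with
  | nil => simp
  | cons a x ih => cases b <;> cases c <;> simp_all

lemma eq_map_false {L : List (Bool × α)} (h : labelled true L = []) :
    L = (labelled false L).map (Prod.mk false) := by
  induction L with
  | nil => rfl
  | cons p L ih =>
    obtain ⟨_ | _, a⟩ := p
    · simpa using ih (by simpa using h)
    · simp at h

variable [LinearOrder α]

lemma not_append_lt (x y : List α) : ¬ x ++ y < x := by
  induction x with
  | nil => simp
  | cons a x ih => simpa [List.cons_lt_cons_iff] using ih

lemma lt_append_right {x y : List α} (h : x < y) (z : List α) : x < y ++ z :=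
  h.trans_le (not_lt.1 (not_append_lt y z))

/-- Exchange argument: if the `false` word is ahead of the `true` word by `d`, relabel the
shuffle so that the `true` word is ahead by `d`; if `y < x` for the remaining words, this can be
done without decreasing the shuffled word, and the two words draw level if it is unchanged. -/
lemma exists_exchange (R : List (Bool × α)) (d x y : List α)
    (ht : labelled true R = d ++ x) (hf : labelled false R = y) (hxy : y < x) :
    ∃ R' : List (Bool × α), labelled true R' = x ∧ labelled false R' = d ++ y ∧
      (R.map Prod.snd < R'.map Prod.snd ∨ R.map Prod.snd = R'.map Prod.snd ∧
        ∃ P S, R' = P ++ S ∧ d ++ labelled true P = labelled false P) := by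
  induction R generalizing d x y with
  | nil =>
    simp at ht
    simp [ht.2] at hxy
  | cons p R ih =>
    rcases d with _ | ⟨e, d⟩
    · exact ⟨p :: R, by simpa using ht, by simpa using hf, .inr ⟨rfl, [], p :: R, by simp⟩⟩
    obtain ⟨_ | _, b⟩ := p
    · rcases x with _ | ⟨c, x⟩
      · simp at hxy
      simp only [labelled_false_cons_false] at hf
      subst hf
      rcases List.cons_lt_cons_iff.1 hxy with hbc | ⟨rfl, hlt⟩
      · refine ⟨(true, c) :: (x.map (Prod.mk true) ++
          (e :: d ++ b :: labelled false R).map (Prod.mk false)), ?_, ?_, .inl ?_⟩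
        · simp
        · simp
        · simp [List.cons_lt_cons_iff, hbc]
      · obtain ⟨R', h1, h2, h3⟩ := ih (e :: d ++ [b]) x _ (by simpa using ht) rfl hlt
        refine ⟨(true, b) :: R', by simp [h1], by simp [h2], ?_⟩
        rcases h3 with h3 | ⟨h3, P, S, rfl, h4⟩
        · exact .inl (by simpa [List.cons_lt_cons_iff] using h3)
        · exact .inr ⟨by simpa using h3, (true, b) :: P, S, rfl, by simpa using h4⟩
    · simp only [labelled_true_cons_true, List.cons_append, List.cons.injEq] at ht
      obtain ⟨rfl, ht⟩ := ht
      obtain ⟨R', h1, h2, h3⟩ := ih d x y ht (by simpa using hf) hxy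
      refine ⟨(false, b) :: R', by simp [h1], by simp [h2], ?_⟩
      rcases h3 with h3 | ⟨h3, P, S, rfl, h4⟩
      · exact .inl (by simpa [List.cons_lt_cons_iff] using h3)
      · exact .inr ⟨by simpa using h3, (false, b) :: P, S, rfl, by simpa using h4⟩

/-- If every nonempty suffix of `x` is larger than `y`, then `x ++ y` is the largest shuffle of
`x` and `y`, and it is obtained in only one way. -/
lemma shuffle_lt_or_eq (x y : List α) (hxy : ∀ s, s ≠ [] → s <:+ x → y < s)
    (L : List (Bool × α)) (ht : labelled true L = x) (hf : labelled false L = y) :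
    L.map Prod.snd < x ++ y ∨ L = x.map (Prod.mk true) ++ y.map (Prod.mk false) := by
  induction x generalizing L with
  | nil =>
    right
    simpa [hf] using eq_map_false ht
  | cons a x ih =>
    have ih' := ih fun s hs h => hxy s hs (h.trans (List.suffix_cons a x))
    have hax := hxy _ (List.cons_ne_nil a x) List.suffix_rfl
    rcases L with _ | ⟨⟨_ | _, b⟩, L⟩
    · simp at ht
    · left
      simp only [labelled_false_cons_false, labelled_true_cons_false] at hf ht
      subst hf
      rcases List.cons_lt_cons_iff.1 hax with hba | ⟨rfl, hlt⟩
      · simp [List.cons_lt_cons_iff, hba]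
      obtain ⟨R, h1, h2, h3⟩ := exists_exchange L [b] x _ (by simpa using ht) rfl hlt
      suffices h : L.map Prod.snd < x ++ b :: labelled false L by
        simpa [List.cons_lt_cons_iff] using h
      rcases h3 with h3 | ⟨h3, P, S, h4, h5⟩ <;> rcases ih' R h1 h2 with h | h
      · exact h3.trans h
      · simpa [h, Function.comp_def] using h3
      · exact h3 ▸ h
      · exfalso
        rcases List.append_eq_append_iff.1 (h4.symm.trans h) with ⟨z, hz, -⟩ | ⟨z, rfl, hz⟩
        · have := congrArg (labelled false) hz
          simp [← h5] at this
        · have hz' := congrArg (labelled false) hz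
          have hz'' := congrArg (labelled true) hz
          simp only [labelled_append, labelled_map, ↓reduceIte] at hz' hz''
          have hzt : labelled true z = [] := (List.append_eq_nil_iff.1 hz''.symm).1
          simp [hzt] at h5
          rw [hz', ← h5] at hax
          exact not_append_lt (b :: x) _ hax
    · simp only [labelled_false_cons_true, labelled_true_cons_true, List.cons.injEq] at hf ht
      obtain ⟨rfl, ht⟩ := ht
      simpa [List.cons_lt_cons_iff] using ih' L ht hf

end Shuffles

lemma exists_labelled_of_shAux_ne_zero (n : ℕ) (x y w : List (Fin (n+2)))
    (h : shAux n x y w ≠ 0) :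
    ∃ L : List (Bool × Fin (n+2)), labelled false L = x ∧ labelled true L = y ∧
      L.map Prod.snd = w := by
  induction x, y using shAux.induct generalizing w with
  | case1 y =>
    rw [shAux] at h
    obtain rfl : y = w := by
      by_contra hne
      exact h (by simp [hne])
    exact ⟨y.map (Prod.mk true), by simp [Function.comp_def]⟩
  | case2 x hx =>
    rw [shAux] at h
    · obtain rfl : x = w := by
        by_contra hne
        exact h (by simp [hne])
      exact ⟨x.map (Prod.mk false), by simp [Function.comp_def]⟩
    · exact hx
  | case3 i x j y ih1 ih2 =>
    rw [shAux, Finsupp.add_apply, Finsupp.smul_apply] at h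
    have hw : ∀ (k : Fin (n+2)) (f : F n), Finsupp.mapDomain (List.cons k) f w ≠ 0 →
        ∃ v, w = k :: v ∧ f v ≠ 0 := by
      intro k f hf
      by_cases hk : w ∈ Set.range (List.cons k)
      · obtain ⟨v, rfl⟩ := hk
        rw [Finsupp.mapDomain_apply List.cons_injective] at hf
        exact ⟨v, rfl, hf⟩
      · exact absurd (Finsupp.mapDomain_of_notMem_range _ _ hk) hf
    by_cases h1 : Finsupp.mapDomain (List.cons i) (shAux n x (j :: y)) w = 0
    · rw [h1, zero_add] at h
      obtain ⟨v, rfl, hv⟩ := hw _ _ (right_ne_zero_of_smul h)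
      obtain ⟨L, h1, h2, h3⟩ := ih2 v hv
      exact ⟨(true, j) :: L, by simp [h1, h2, h3]⟩
    · obtain ⟨v, rfl, hv⟩ := hw _ _ h1
      obtain ⟨L, h1, h2, h3⟩ := ih1 v hv
      exact ⟨(false, i) :: L, by simp [h1, h2, h3]⟩

/-- If `x ++ y` arises in only one way as a shuffle of `x` and `y`, its coefficient is `1`. -/
lemma shAux_append_eq_one (n : ℕ) (x y : List (Fin (n+2)))
    (h : ∀ L : List (Bool × Fin (n+2)), labelled false L = x → labelled true L = y →
      L.map Prod.snd = x ++ y → L = x.map (Prod.mk false) ++ y.map (Prod.mk true)) :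
    shAux n x y (x ++ y) = 1 := by
  induction x with
  | nil => simp [shAux]
  | cons i x ih =>
    rcases y with _ | ⟨j, y⟩
    · simp [shAux]
    have h1 := ih fun L hf ht hL => by
      simpa using h ((false, i) :: L) (by simp [hf]) (by simp [ht]) (by simp [hL])
    have h2 : Finsupp.mapDomain (List.cons j) (shAux n (i :: x) y) (i :: (x ++ j :: y)) = 0 := by
      by_cases hij : i = j
      · subst hij
        rw [Finsupp.mapDomain_apply List.cons_injective]
        by_contra hne
        obtain ⟨L, hf, ht, hL⟩ := exists_labelled_of_shAux_ne_zero n _ _ _ hne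
        have := h ((true, i) :: L) (by simp [hf]) (by simp [ht]) (by simp [hL])
        simp at this
      · apply Finsupp.mapDomain_of_notMem_range
        rintro ⟨v, hv⟩
        exact hij (List.cons.inj hv).1.symm
    rw [shAux, List.cons_append, Finsupp.add_apply, Finsupp.smul_apply, h2, smul_zero, add_zero,
      Finsupp.mapDomain_apply List.cons_injective, h1]

lemma lt_of_suffix_rep (n m : ℕ) (i j : List (Fin (n+2))) (hi : IsLyndonW n i)
    (hij : wlt n j i) (s : List (Fin (n+2))) (hs : s ≠ []) (h : s <:+ rep n m i) : j < s := by
  induction m with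
  | zero => simp_all [rep]
  | succ m ih =>
    have hrep : rep n (m + 1) i = i ++ rep n m i := by simp [rep, List.replicate_succ]
    rw [hrep] at h
    obtain ⟨t, ht⟩ := h
    rcases List.append_eq_append_iff.1 ht with ⟨u, hu, rfl⟩ | ⟨u, -, hu⟩
    · by_cases hu0 : u = []
      · subst hu0
        exact ih ⟨[], by simp⟩
      · refine lt_append_right ?_ _
        by_cases ht0 : t = []
        · simpa [hu, ht0] using (show j < i from hij)
        · exact (show j < i from hij).trans (hi.2 t u hu ht0 hu0)
    · exact ih ⟨u, hu.symm⟩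

/-- Let `𝐢` be a Lyndon word, `𝐣` a dominant word with `𝐢 ≻ 𝐣`,
and `m > 0`.  Then the coefficient of the concatenated word `𝐢^m 𝐣` in the shuffle
product `𝐣 ⋄ 𝐢^m` is `1`. -/
theorem stmt11 (n m : ℕ) (hm : 0 < m) (i j : List (Fin (n+2)))
    (hi : IsLyndonW n i) (hj : IsDominant n j) (hij : wlt n j i) :
    (shw n j (rep n m i)) (rep n m i ++ j) = 1 := by
  have hrev : rep n m i ++ j = (j.reverse ++ (rep n m i).reverse).reverse := by simp
  rw [shw, hrev, Finsupp.mapDomain_apply List.reverse_injective]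
  refine shAux_append_eq_one n _ _ fun L hf ht hL => ?_
  have key := shuffle_lt_or_eq (rep n m i) j (lt_of_suffix_rep n m i j hi hij) L.reverse
    (by simp [ht]) (by simp [hf])
  rw [List.map_reverse, hL, ← hrev] at key
  have := key.resolve_left (lt_irrefl _)
  simpa using congrArg List.reverse this

end SpinQHA
end
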